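/- arXiv:1001.1012 — 10 statements merged into one kernel-verified Lean document; each statement's English description precedes it below -/
import Mathlib

section
/- (Bochner–Minlos theorem for ℝ^(ℕ), existence direction.) Let ω : ℝ^(ℕ) → ℂ be a normalized positive definite function such that for every n ∈ ℕ the map ℝ^{n+1} → ℂ, (t_0,…,t_n) ↦ ω(∑_{k=0}^n t_k e_k), is continuous, where e_k is the k-th standard basis element of ℝ^(ℕ). Then there exists a Borel probability measure μ on ℝ^ℕ (with the product topology and its Borel σ-algebra) such that ω(x) = ∫_{ℝ^ℕ} exp(i⟨x,y⟩) dμ(y) for all x ∈ ℝ^(ℕ). -/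
open MeasureTheory Complex
open scoped ComplexOrder

/-- Positive definiteness of a complex-valued function on an additive group. -/
def IsPosDefFun {G : Type*} [AddGroup G] (φ : G → ℂ) : Prop :=
  ∀ (m : ℕ) (x : Fin m → G) (c : Fin m → ℂ),
    0 ≤ ∑ i, ∑ j, c i * starRingEnd ℂ (c j) * φ (x i - x j)

namespace IsPosDefFun

variable {G : Type*} [AddGroup G] {φ : G → ℂ}

lemma sum_nonneg (hφ : IsPosDefFun φ) {κ : Type*} [Fintype κ] (x : κ → G) (c : κ → ℂ) :
    0 ≤ ∑ i, ∑ j, c i * starRingEnd ℂ (c j) * φ (x i - x j) := by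
  let e := Fintype.equivFin κ
  have h := hφ (Fintype.card κ) (x ∘ e.symm) (c ∘ e.symm)
  have key := Equiv.sum_comp e.symm
    fun i ↦ ∑ j, c i * starRingEnd ℂ (c j) * φ (x i - x j)
  rw [← key]
  convert h using 2 with i
  exact (Equiv.sum_comp e.symm
    fun j ↦ c (e.symm i) * starRingEnd ℂ (c j) * φ (x (e.symm i) - x j)).symm

lemma norm_le_one (hφ : IsPosDefFun φ) (h0 : φ 0 = 1) (x : G) : ‖φ x‖ ≤ 1 := by
  have key (a b : ℂ) : 0 ≤ a * starRingEnd ℂ a + b * starRingEnd ℂ b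
      + a * starRingEnd ℂ b * φ x + b * starRingEnd ℂ a * φ (-x) := by
    have h := hφ 2 ![x, 0] ![a, b]
    simp only [Fin.sum_univ_two, Matrix.cons_val_zero, Matrix.cons_val_one, sub_self, h0,
      sub_zero, zero_sub, mul_one] at h
    convert h using 1
    ring
  have h1 := (Complex.le_def.1 (key 1 1)).2
  have h2 := (Complex.le_def.1 (key 1 I)).2
  have h3 := (Complex.le_def.1 (key (-starRingEnd ℂ (φ x)) 1)).1
  simp at h1 h2 h3
  have hre : (φ (-x)).re = (φ x).re := by linarith
  have him : (φ (-x)).im = -(φ x).im := by linarith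
  rw [hre, him] at h3
  have : ‖φ x‖ ^ 2 ≤ 1 := by
    rw [← Complex.normSq_eq_norm_sq, Complex.normSq_apply]
    nlinarith
  exact (sq_le_one_iff₀ (norm_nonneg _)).1 this

end IsPosDefFun

namespace ZMod

variable {ι : Type*} [Fintype ι] [DecidableEq ι] {M : ℕ} [NeZero M]

lemma sum_stdAddChar_dotProduct (a : ι → ZMod M) [Decidable (a = 0)] :
    ∑ l : ι → ZMod M, stdAddChar (l ⬝ᵥ a)
      = if a = 0 then (Fintype.card (ι → ZMod M) : ℂ) else 0 := by
  let ψ : AddChar (ι → ZMod M) ℂ :=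
    { toFun := fun l ↦ stdAddChar (l ⬝ᵥ a)
      map_zero_eq_one' := by simp
      map_add_eq_mul' := fun l l' ↦ by simp [add_dotProduct, AddChar.map_add_eq_mul] }
  classical
  have hψ : ψ = 0 ↔ a = 0 := by
    refine ⟨fun h ↦ funext fun i ↦ ?_, fun h ↦ ?_⟩
    · have h' : stdAddChar (Pi.single i 1 ⬝ᵥ a) = (1 : ℂ) := DFunLike.congr_fun h (Pi.single i 1)
      rw [single_one_dotProduct, ← AddChar.map_zero_eq_one (stdAddChar (N := M))] at h'
      exact injective_stdAddChar h'
    · ext l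
      simp [ψ, h]
  have := AddChar.sum_eq_ite ψ
  simp only [hψ] at this
  simpa [ψ] using this

end ZMod

/-- A tail bound for a `[-π, π]`-valued random variable in terms of its Fourier coefficients. -/
lemma measureReal_le_sum_norm_one_sub_integral_exp {Ω : Type*} [MeasurableSpace Ω]
    {ν : Measure Ω} [IsProbabilityMeasure ν] {f : Ω → ℝ} (hf : Measurable f)
    (hfπ : ∀ᵐ θ ∂ν, |f θ| ≤ Real.pi) {K : ℕ} (hK : 0 < K) :
    ν.real {θ | 2 * Real.pi / K ≤ |f θ|}
      ≤ 2 / K * ∑ k ∈ Finset.range K, ‖1 - ∫ θ, exp (I * ((k * f θ : ℝ) : ℂ)) ∂ν‖ := by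
  have hK' : (0 : ℝ) < K := by exact_mod_cast hK
  have hint (k : ℕ) : Integrable (fun θ ↦ exp (I * ((k * f θ : ℝ) : ℂ))) ν := by
    refine Integrable.of_bound (by fun_prop) 1 (.of_forall fun θ ↦ ?_)
    rw [norm_exp_I_mul_ofReal]
  let g : Ω → ℝ := fun θ ↦
    (K : ℝ)⁻¹ * ∑ k ∈ Finset.range K, (1 - exp (I * ((k * f θ : ℝ) : ℂ))).re
  have hint_re (k : ℕ) : Integrable (fun θ ↦ (1 - exp (I * ((k * f θ : ℝ) : ℂ))).re) ν :=
    ((integrable_const _).sub (hint k)).re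
  have hg_int : Integrable g ν := (integrable_finsetSum _ fun k _ ↦ hint_re k).const_mul _
  have hg_nonneg (θ : Ω) : 0 ≤ g θ := by
    refine mul_nonneg (by positivity) (Finset.sum_nonneg fun k _ ↦ ?_)
    have := (re_le_norm (exp (I * ((k * f θ : ℝ) : ℂ))))
    rw [norm_exp_I_mul_ofReal] at this
    rw [sub_re, one_re]
    linarith
  have hg_half : ∀ᵐ θ ∂ν, θ ∈ {θ | 2 * Real.pi / K ≤ |f θ|} → θ ∈ {θ | 1 / 2 ≤ g θ} := by
    filter_upwards [hfπ] with θ hθ hKθ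
    have hpos : 0 < |f θ| := lt_of_lt_of_le (by positivity) hKθ
    set z : ℂ := exp (I * (f θ : ℂ)) with hz
    have hz1 : 2 / Real.pi * |f θ| ≤ ‖z - 1‖ := by
      rw [hz, norm_exp_I_mul_ofReal_sub_one, norm_mul, Real.norm_eq_abs, Real.norm_eq_abs, abs_two]
      have := Real.mul_abs_le_abs_sin (x := f θ / 2) (by rw [abs_div, abs_two]; linarith)
      rw [abs_div, abs_two] at this
      linarith
    have hz1' : 0 < ‖z - 1‖ := lt_of_lt_of_le (by positivity) hz1
    have hzne : z ≠ 1 := fun h ↦ by simp [h] at hz1'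
    have hpow (k : ℕ) : exp (I * ((k * f θ : ℝ) : ℂ)) = z ^ k := by
      rw [hz, ← Complex.exp_nat_mul]
      push_cast
      ring_nf
    have hgeom : ‖∑ k ∈ Finset.range K, z ^ k‖ ≤ K / 2 := by
      rw [geom_sum_eq hzne, norm_div, div_le_iff₀ hz1']
      have hzn : ‖z‖ = 1 := by rw [hz, norm_exp_I_mul_ofReal]
      calc ‖z ^ K - 1‖ ≤ ‖z ^ K‖ + ‖(1 : ℂ)‖ := norm_sub_le _ _
        _ = 2 := by rw [norm_pow, hzn]; norm_num
        _ = K / 2 * (2 / Real.pi * (2 * Real.pi / K)) := by field_simp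
        _ ≤ K / 2 * ‖z - 1‖ := by
          refine mul_le_mul_of_nonneg_left (le_trans ?_ hz1) (by positivity)
          gcongr
    have hre := (re_le_norm (∑ k ∈ Finset.range K, z ^ k)).trans hgeom
    simp only [g, hpow, sub_re, one_re, Finset.sum_sub_distrib, ← re_sum, Finset.sum_const,
      Finset.card_range, nsmul_eq_mul, mul_one]
    rw [inv_mul_eq_div, le_div_iff₀ hK']
    linarith
  calc ν.real {θ | 2 * Real.pi / K ≤ |f θ|} ≤ ν.real {θ | 1 / 2 ≤ g θ} :=
        ENNReal.toReal_mono (measure_ne_top _ _) (measure_mono_ae hg_half)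
    _ ≤ 2 * ∫ θ, g θ ∂ν := by
        have := mul_meas_ge_le_integral_of_nonneg (.of_forall hg_nonneg) hg_int (1 / 2)
        linarith
    _ = 2 / K * ∑ k ∈ Finset.range K, (1 - ∫ θ, exp (I * ((k * f θ : ℝ) : ℂ)) ∂ν).re := by
        simp only [g]
        rw [integral_const_mul, integral_finsetSum _ fun k _ ↦ hint_re k, ← mul_assoc,
          div_eq_mul_inv]
        congr 1
        refine Finset.sum_congr rfl fun k _ ↦ ?_
        have := integral_re ((integrable_const (1 : ℂ)).sub (hint k))
        simp only [Pi.sub_apply, RCLike.re_to_complex] at this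
        rw [this, integral_sub (integrable_const _) (hint k)]
        simp
    _ ≤ _ := by
        gcongr with k _
        exact re_le_norm _

namespace IsPosDefFun

variable {ι : Type*} [Fintype ι] [DecidableEq ι] {φ : (ι → ℤ) → ℂ} {M : ℕ} [NeZero M]

/-- The discrete Fourier transform, at frequency `l`, of a positive definite function averaged over
the box `[0, M)^ι`. -/
noncomputable def boxWeight (φ : (ι → ℤ) → ℂ) (l : ι → ZMod M) : ℂ :=
  ((Fintype.card (ι → ZMod M) : ℂ) ^ 2)⁻¹ * ∑ j : ι → ZMod M, ∑ k : ι → ZMod M,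
    ZMod.stdAddChar (l ⬝ᵥ (k - j)) * φ ((fun i ↦ ((j i).val : ℤ)) - fun i ↦ ((k i).val : ℤ))

lemma boxWeight_nonneg (hφ : IsPosDefFun φ) (l : ι → ZMod M) : 0 ≤ boxWeight φ l := by
  have hC : (0 : ℂ) ≤ ((Fintype.card (ι → ZMod M) : ℂ) ^ 2)⁻¹ := by
    rw [← ofReal_natCast, ← ofReal_pow, ← ofReal_inv, zero_le_real]
    positivity
  refine mul_nonneg hC ?_
  convert hφ.sum_nonneg (fun (j : ι → ZMod M) i ↦ ((j i).val : ℤ))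
    (fun j ↦ ZMod.stdAddChar (l ⬝ᵥ (-j))) using 6 with j _ k _
  rw [ZMod.stdAddChar_apply (l ⬝ᵥ (-k)), ← Circle.coe_inv_eq_conj, ← AddChar.map_neg_eq_inv,
    ← ZMod.stdAddChar_apply, ← AddChar.map_add_eq_mul, dotProduct_sub, dotProduct_neg,
    dotProduct_neg]
  congr 1
  ring

lemma sum_boxWeight_mul_stdAddChar (φ : (ι → ℤ) → ℂ) (a : ι → ZMod M) :
    ∑ l, boxWeight φ l * ZMod.stdAddChar (l ⬝ᵥ a)
      = (Fintype.card (ι → ZMod M) : ℂ)⁻¹ * ∑ k : ι → ZMod M,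
        φ ((fun i ↦ (((k + a) i).val : ℤ)) - fun i ↦ ((k i).val : ℤ)) := by
  have hC : (Fintype.card (ι → ZMod M) : ℂ) ≠ 0 := Nat.cast_ne_zero.2 Fintype.card_ne_zero
  calc ∑ l, boxWeight φ l * ZMod.stdAddChar (l ⬝ᵥ a)
    _ = ((Fintype.card (ι → ZMod M) : ℂ) ^ 2)⁻¹ * ∑ k : ι → ZMod M, ∑ j : ι → ZMod M,
          φ ((fun i ↦ ((j i).val : ℤ)) - fun i ↦ ((k i).val : ℤ))
            * ∑ l, ZMod.stdAddChar (l ⬝ᵥ (k + a - j)) := by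
      simp_rw [boxWeight, mul_assoc, ← Finset.mul_sum, Finset.sum_mul, Finset.mul_sum]
      rw [Finset.sum_comm]
      conv_lhs => enter [2, j]; rw [Finset.sum_comm]
      rw [Finset.sum_comm]
      refine Finset.sum_congr rfl fun k _ ↦ Finset.sum_congr rfl fun j _ ↦
        Finset.sum_congr rfl fun l _ ↦ ?_
      rw [add_sub_right_comm, dotProduct_add, AddChar.map_add_eq_mul]
      ring
    _ = _ := by
      simp_rw [ZMod.sum_stdAddChar_dotProduct, sub_eq_zero, mul_ite, mul_zero,
        Finset.sum_ite_eq, Finset.mem_univ, if_true, ← Finset.sum_mul]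
      field_simp

lemma sum_boxWeight (h0 : φ 0 = 1) : ∑ l : ι → ZMod M, boxWeight φ l = 1 := by
  simpa [h0] using sum_boxWeight_mul_stdAddChar φ (0 : ι → ZMod M)

lemma norm_sum_boxWeight_sub_le (hφ : IsPosDefFun φ) (h0 : φ 0 = 1) {B : ℕ} (hB : 2 * B ≤ M)
    (n : ι → ℤ) (hn : ∀ i, |n i| ≤ B) :
    ‖∑ l : ι → ZMod M, boxWeight φ l * ZMod.stdAddChar (l ⬝ᵥ fun i ↦ (n i : ZMod M)) - φ n‖
      ≤ 4 * B * Fintype.card ι / M := by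
  classical
  set C := Fintype.card (ι → ZMod M) with hC
  have hM0 : (0 : ℝ) < M := by exact_mod_cast Nat.pos_of_neZero M
  have hCM : (C : ℝ) = (M : ℝ) ^ Fintype.card ι := by simp [hC, ZMod.card]
  have hC0 : (0 : ℝ) < C := by rw [hCM]; positivity
  have hC0' : (C : ℂ) ≠ 0 := by exact_mod_cast hC0.ne'
  let S : Finset (ZMod M) := {a | B ≤ a.val ∧ a.val < M - B}
  have hS : M - 2 * B ≤ S.card := by
    have : (Finset.Ico B (M - B)).card ≤ S.card := by
      refine Finset.card_le_card_of_injOn (fun m ↦ (m : ZMod M)) (fun m hm ↦ ?_) ?_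
      · have hm' := Finset.mem_Ico.1 (Finset.mem_coe.1 hm)
        simp only [S, Finset.coe_filter, Finset.mem_univ, true_and, Set.mem_ofPred_eq]
        rw [ZMod.val_cast_of_lt (by omega)]
        exact hm'
      · intro m hm m' hm' h
        have hm₁ := Finset.mem_Ico.1 (Finset.mem_coe.1 hm)
        have hm₂ := Finset.mem_Ico.1 (Finset.mem_coe.1 hm')
        have := congrArg ZMod.val h
        simpa only [ZMod.val_cast_of_lt (show m < M by omega),
          ZMod.val_cast_of_lt (show m' < M by omega)] using this
    rw [Nat.card_Ico] at this
    omega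
  let T : Finset (ι → ZMod M) := Fintype.piFinset fun _ ↦ S
  have hT : (1 - 2 * B * Fintype.card ι / M) * C ≤ (T.card : ℝ) := by
    have hT1 : ((M : ℝ) - 2 * B) ^ Fintype.card ι ≤ T.card := by
      rw [Fintype.card_piFinset, Finset.prod_const, Finset.card_univ, Nat.cast_pow]
      have : (M : ℝ) ≤ S.card + 2 * B := by exact_mod_cast (by omega : M ≤ S.card + 2 * B)
      have : 2 * (B : ℝ) ≤ M := by exact_mod_cast hB
      exact pow_le_pow_left₀ (by linarith) (by linarith) _
    refine le_trans ?_ hT1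
    have hBM : 2 * (B : ℝ) / M ≤ 1 := by rw [div_le_one hM0]; exact_mod_cast hB
    have := one_add_mul_le_pow (a := -(2 * (B : ℝ) / M)) (by linarith) (Fintype.card ι)
    calc (1 - 2 * B * Fintype.card ι / M) * (C : ℝ)
        = (1 + Fintype.card ι * -(2 * (B : ℝ) / M)) * (M : ℝ) ^ Fintype.card ι := by
          rw [hCM]; ring
      _ ≤ (1 + -(2 * (B : ℝ) / M)) ^ Fintype.card ι * (M : ℝ) ^ Fintype.card ι := by gcongr
      _ = _ := by
          rw [← mul_pow]
          congr 1
          field_simp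
          ring
  have hgood (k : ι → ZMod M) (hk : k ∈ T) :
      φ ((fun i ↦ (((k + fun i ↦ (n i : ZMod M)) i).val : ℤ)) - fun i ↦ ((k i).val : ℤ)) = φ n := by
    congr 1
    ext i
    have hki : B ≤ (k i).val ∧ (k i).val < M - B := by
      simpa [S] using Fintype.mem_piFinset.1 hk i
    have hni := abs_le.1 (hn i)
    have hval : (((k i).val : ℤ) + n i).toNat < M := by omega
    have : k i + (n i : ZMod M) = ((((k i).val : ℤ) + n i).toNat : ZMod M) := by
      rw [← Int.cast_natCast (R := ZMod M), Int.toNat_of_nonneg (by omega)]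
      simp
    simp only [Pi.add_apply, Pi.sub_apply]
    rw [this, ZMod.val_cast_of_lt hval, Int.toNat_of_nonneg (by omega)]
    ring
  have hsum : ∑ l : ι → ZMod M, boxWeight φ l * ZMod.stdAddChar (l ⬝ᵥ fun i ↦ (n i : ZMod M)) - φ n
      = (C : ℂ)⁻¹ * ∑ k : ι → ZMod M, (φ ((fun i ↦ (((k + fun i ↦ (n i : ZMod M)) i).val : ℤ))
        - fun i ↦ ((k i).val : ℤ)) - φ n) := by
    rw [sum_boxWeight_mul_stdAddChar, Finset.sum_sub_distrib, Finset.sum_const, Finset.card_univ,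
      nsmul_eq_mul, ← hC, mul_sub, inv_mul_cancel_left₀ hC0']
  have hTc : (Tᶜ.card : ℝ) = C - T.card := by
    rw [Finset.card_compl, Nat.cast_sub (Finset.card_le_univ _)]
  calc _ = (C : ℝ)⁻¹ * ‖∑ k ∈ Tᶜ, (φ ((fun i ↦ (((k + fun i ↦ (n i : ZMod M)) i).val : ℤ))
        - fun i ↦ ((k i).val : ℤ)) - φ n)‖ := by
        rw [hsum, norm_mul, norm_inv, norm_natCast, ← Finset.sum_add_sum_compl T,
          Finset.sum_eq_zero (s := T) fun k hk ↦ by rw [hgood k hk, sub_self], zero_add]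
    _ ≤ (C : ℝ)⁻¹ * (Tᶜ.card • 2) := by
        gcongr
        refine (norm_sum_le _ _).trans (Finset.sum_le_card_nsmul _ _ _ fun k _ ↦ ?_)
        refine (norm_sub_le _ _).trans ?_
        linarith [hφ.norm_le_one h0 n, hφ.norm_le_one h0
          ((fun i ↦ (((k + fun i ↦ (n i : ZMod M)) i).val : ℤ)) - fun i ↦ ((k i).val : ℤ))]
    _ ≤ (C : ℝ)⁻¹ * ((2 * B * Fintype.card ι / M * C) * 2) := by
        rw [nsmul_eq_mul, hTc]
        gcongr
        linarith
    _ = _ := by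
        field_simp
        ring

/-- An approximate multidimensional Herglotz theorem: finitely many values of a normalized positive
definite function on `ℤ^ι` are approximately Fourier coefficients of a probability measure
on `[-π, π]^ι`. -/
lemma exists_measure_norm_integral_exp_sub_le (hφ : IsPosDefFun φ) (h0 : φ 0 = 1) (B : ℕ)
    {ε : ℝ} (hε : 0 < ε) :
    ∃ ν : Measure (ι → ℝ), IsProbabilityMeasure ν ∧ (∀ᵐ θ ∂ν, ∀ i, |θ i| ≤ Real.pi) ∧
      ∀ n : ι → ℤ, (∀ i, |n i| ≤ B) →
        ‖∫ θ, exp (I * ((∑ i, n i * θ i : ℝ) : ℂ)) ∂ν - φ n‖ ≤ ε := by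
  obtain ⟨m, hm⟩ := exists_nat_gt (4 * B * Fintype.card ι / ε)
  let M := m + 2 * B + 1
  have hM0 : (0 : ℝ) < M := by positivity
  let θ (l : ι → ZMod M) (i : ι) : ℝ := 2 * Real.pi * (l i).valMinAbs / M
  have hre (l : ι → ZMod M) : boxWeight φ l = ((boxWeight φ l).re : ℂ) :=
    eq_re_of_ofReal_le (r := 0) (by simpa using hφ.boxWeight_nonneg l)
  have hre0 (l : ι → ZMod M) : 0 ≤ (boxWeight φ l).re := (le_def.1 (hφ.boxWeight_nonneg l)).1
  let ν : Measure (ι → ℝ) :=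
    ∑ l : ι → ZMod M, ENNReal.ofReal (boxWeight φ l).re • Measure.dirac (θ l)
  refine ⟨ν, ⟨?_⟩, ?_, fun n hn ↦ ?_⟩
  · have : ∑ l : ι → ZMod M, (boxWeight φ l).re = 1 := by
      rw [← re_sum, sum_boxWeight h0, one_re]
    simp [ν, Measure.finsetSum_apply, ← ENNReal.ofReal_sum_of_nonneg fun l _ ↦ hre0 l, this]
  · refine ae_finsetSum_measure_iff.2 fun l _ ↦ Measure.ae_smul_measure ?_ _
    rw [ae_dirac_eq]
    intro i
    have hl := (l i).valMinAbs_mem_Ioc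
    have h1 : -(M : ℝ) ≤ (l i).valMinAbs * 2 := by exact_mod_cast hl.1.le
    have h2 : ((l i).valMinAbs * 2 : ℝ) ≤ M := by exact_mod_cast hl.2
    have h3 : |((l i).valMinAbs : ℝ)| * 2 ≤ M := by
      rw [← abs_two (α := ℝ), ← abs_mul]
      exact abs_le.2 ⟨h1, h2⟩
    simp only [θ]
    rw [abs_div, abs_mul, abs_of_pos hM0, abs_of_pos Real.two_pi_pos, div_le_iff₀ hM0]
    nlinarith [Real.pi_pos]
  · have hint : ∫ t, exp (I * ((∑ i, n i * t i : ℝ) : ℂ)) ∂ν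
        = ∑ l : ι → ZMod M, boxWeight φ l * ZMod.stdAddChar (l ⬝ᵥ fun i ↦ (n i : ZMod M)) := by
      rw [integral_finsetSum_measure fun l _ ↦
        (integrable_dirac (by simp)).smul_measure ENNReal.ofReal_ne_top]
      refine Finset.sum_congr rfl fun l _ ↦ ?_
      rw [integral_smul_measure, integral_dirac, ENNReal.toReal_ofReal (hre0 l), real_smul, ← hre]
      congr 1
      have : (l ⬝ᵥ fun i ↦ (n i : ZMod M)) = ((∑ i, (l i).valMinAbs * n i : ℤ) : ZMod M) := by
        simp [dotProduct]
      rw [this, ZMod.stdAddChar_coe]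
      congr 1
      push_cast [θ]
      rw [Finset.mul_sum, Finset.mul_sum, Finset.sum_div]
      refine Finset.sum_congr rfl fun i _ ↦ ?_
      ring
    rw [hint]
    refine (hφ.norm_sum_boxWeight_sub_le h0 (by omega) n hn).trans ?_
    rw [div_lt_iff₀ hε] at hm
    rw [div_le_iff₀ hM0]
    have : (m : ℝ) ≤ M := by exact_mod_cast (by omega : m ≤ M)
    nlinarith

end IsPosDefFun

/-- A set of measures on `ℕ → ℝ` is tight as soon as each of its coordinates is. -/
lemma isTightMeasureSet_of_forall_coordinate {S : Set (Measure (ℕ → ℝ))}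
    (hS : ∀ (i : ℕ) (ε : ENNReal), 0 < ε → ∃ R : ℝ, ∀ μ ∈ S, μ {y | R < |y i|} ≤ ε) :
    IsTightMeasureSet S := by
  rw [isTightMeasureSet_iff_exists_isCompact_measure_compl_le]
  intro ε hε
  obtain ⟨δ, hδ, hδsum⟩ := ENNReal.exists_pos_sum_of_countable hε.ne' ℕ
  choose R hR using fun i ↦ hS i (δ i) (by exact_mod_cast hδ i)
  refine ⟨Set.univ.pi fun i ↦ Set.Icc (-R i) (R i), isCompact_univ_pi fun i ↦ isCompact_Icc,
    fun μ hμ ↦ ?_⟩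
  calc μ (Set.univ.pi fun i ↦ Set.Icc (-R i) (R i))ᶜ
      ≤ μ (⋃ i, {y | R i < |y i|}) := by
        refine measure_mono fun y hy ↦ ?_
        by_contra hcon
        refine hy fun i _ ↦ abs_le.1 (not_lt.1 fun hlt ↦ hcon ?_)
        exact Set.mem_iUnion.2 ⟨i, hlt⟩
    _ ≤ ∑' i, μ {y | R i < |y i|} := measure_iUnion_le _
    _ ≤ ∑' i, (δ i : ENNReal) := ENNReal.tsum_le_tsum fun i ↦ hR i μ hμ
    _ ≤ ε := hδsum.le

/-- The pairing of a finitely supported sequence with an arbitrary sequence. -/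
def seqPairing (x : ℕ →₀ ℝ) (y : ℕ → ℝ) : ℝ := x.sum fun n xn ↦ xn * y n

lemma seqPairing_eq_sum_fin {x : ℕ →₀ ℝ} {N : ℕ} (hx : ∀ i, N ≤ i → x i = 0) (y : ℕ → ℝ) :
    seqPairing x y = ∑ i : Fin N, x i * y i := by
  have hsupp : x.support ⊆ Finset.range N := fun i hi ↦ by
    by_contra h
    exact Finsupp.mem_support_iff.1 hi (hx i (by simpa using h))
  rw [seqPairing, Finsupp.sum_of_support_subset _ hsupp _ (by simp),
    Finset.sum_range fun i ↦ x i * y i]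

lemma sum_single_fin_apply {N : ℕ} (t : Fin N → ℝ) (j : ℕ) :
    (∑ i : Fin N, Finsupp.single (i : ℕ) (t i)) j = if h : j < N then t ⟨j, h⟩ else 0 := by
  rw [Finsupp.finsetSum_apply]
  split_ifs with h
  · rw [Finset.sum_eq_single ⟨j, h⟩]
    · simp
    · intro i _ hi
      exact Finsupp.single_eq_of_ne fun h' ↦ hi (Fin.ext h'.symm)
    · simp
  · exact Finset.sum_eq_zero fun i _ ↦ Finsupp.single_eq_of_ne (by omega)

lemma eq_sum_single_fin {x : ℕ →₀ ℝ} {N : ℕ} (hx : ∀ i, N ≤ i → x i = 0) :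
    x = ∑ i : Fin N, Finsupp.single (i : ℕ) (x i) := by
  ext j
  rw [sum_single_fin_apply]
  split_ifs with h
  · rfl
  · exact hx j (not_lt.1 h)

@[fun_prop]
lemma continuous_seqPairing (x : ℕ →₀ ℝ) : Continuous (seqPairing x) :=
  continuous_finsetSum _ fun i _ ↦ continuous_const.mul (continuous_apply i)

lemma IsPosDefFun.comp_addMonoidHom {G H : Type*} [AddGroup G] [AddGroup H] {φ : G → ℂ}
    (hφ : IsPosDefFun φ) (f : H →+ G) : IsPosDefFun (φ ∘ f) := fun m x c ↦ by
  simpa using hφ m (f ∘ x) c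

open scoped Nat in
/-- A normalized positive definite function on `ℝ^(ℕ)` is approximated, on the lattice of mesh
`1 / N!` in a box of the first `N` coordinates, by the Fourier transform of a compactly supported
probability measure. -/
lemma exists_measure_norm_integral_exp_seqPairing_sub_le {ω : (ℕ →₀ ℝ) → ℂ} (hω : IsPosDefFun ω)
    (h0 : ω 0 = 1) (N : ℕ) :
    ∃ μ : Measure (ℕ → ℝ), IsProbabilityMeasure μ ∧ (∀ᵐ y ∂μ, ∀ i, |y i| ≤ Real.pi * N !) ∧
      ∀ x : ℕ →₀ ℝ, (∀ i, N ≤ i → x i = 0) →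
        (∀ i, ∃ n : ℤ, |n| ≤ (N * N ! : ℕ) ∧ x i = n / N !) →
        ‖∫ y, exp (I * (seqPairing x y : ℂ)) ∂μ - ω x‖ ≤ 1 / (N + 1) := by
  have hN : (0 : ℝ) < N ! := by exact_mod_cast N.factorial_pos
  let L : (Fin N → ℤ) →+ (ℕ →₀ ℝ) :=
    { toFun := fun n ↦ ∑ i : Fin N, Finsupp.single (i : ℕ) ((n i : ℝ) / N !)
      map_zero' := by simp
      map_add' := fun n n' ↦ by simp [add_div, Finset.sum_add_distrib] }
  obtain ⟨ν, hν, hνπ, hνφ⟩ := (hω.comp_addMonoidHom L).exists_measure_norm_integral_exp_sub_le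
    (by simp [h0]) (N * N !) (ε := 1 / (N + 1)) (by positivity)
  let F : (Fin N → ℝ) → ℕ → ℝ := fun θ i ↦ if h : i < N then N ! * θ ⟨i, h⟩ else 0
  have hF : Measurable F := by
    refine measurable_pi_lambda _ fun i ↦ ?_
    by_cases h : i < N
    · simp only [F, h, dite_true]
      fun_prop
    · simp only [F, h, dite_false]
      fun_prop
  refine ⟨ν.map F, Measure.isProbabilityMeasure_map hF.aemeasurable, ?_, fun x hx hxn ↦ ?_⟩
  · rw [ae_all_iff]
    intro i
    rw [ae_map_iff hF.aemeasurable (measurableSet_le (by fun_prop) (by fun_prop))]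
    filter_upwards [hνπ] with θ hθ
    by_cases h : i < N
    · simp only [F, h, dite_true]
      rw [abs_mul, abs_of_pos hN, mul_comm]
      gcongr
      exact hθ _
    · simp only [F, h, dite_false, abs_zero]
      positivity
  · choose n hn hxn using hxn
    have hxL : L (fun i ↦ n i) = x := by
      conv_rhs => rw [eq_sum_single_fin hx]
      simp [L, hxn]
    have hpair (θ : Fin N → ℝ) : seqPairing x (F θ) = ∑ i : Fin N, n i * θ i := by
      rw [seqPairing_eq_sum_fin hx]
      refine Finset.sum_congr rfl fun i _ ↦ ?_
      simp only [F, i.isLt, dite_true, Fin.eta, hxn]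
      field_simp
    rw [integral_map hF.aemeasurable (by fun_prop)]
    simp_rw [hpair]
    simpa [hxL] using hνφ (fun i ↦ n i) fun i ↦ hn i

open scoped Nat in
/-- Every normalized positive definite function on `ℝ^(ℕ)` that is continuous at `0` along each
coordinate axis coincides at the rational points with the Fourier transform of a
probability measure. -/
lemma exists_measure_eq_integral_exp_of_rational {ω : (ℕ →₀ ℝ) → ℂ} (hω : IsPosDefFun ω)
    (h0 : ω 0 = 1) (hc : ∀ i, ContinuousAt (fun t : ℝ ↦ ω (Finsupp.single i t)) 0) :
    ∃ μ : Measure (ℕ → ℝ), IsProbabilityMeasure μ ∧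
      ∀ x : ℕ →₀ ℝ, (∀ i, ∃ q : ℚ, x i = q) →
        ω x = ∫ y, exp (I * (seqPairing x y : ℂ)) ∂μ := by
  choose μ hμ hμπ hμω using exists_measure_norm_integral_exp_seqPairing_sub_le hω h0
  have htail (i m N : ℕ) (hm : 0 < m) (hmN : m ≤ N) (hiN : i < N) {ε : ℝ}
      (hε : ∀ t, 0 ≤ t → t ≤ 1 / (m : ℝ) → ‖1 - ω (Finsupp.single i t)‖ ≤ ε) :
      (μ N).real {y | 2 * Real.pi * m ≤ |y i|} ≤ 2 * (ε + 1 / (N + 1)) := by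
    have hN : (0 : ℝ) < N ! := by exact_mod_cast N.factorial_pos
    obtain ⟨K, hK⟩ := Nat.dvd_factorial hm hmN
    have hm' : (0 : ℝ) < m := by exact_mod_cast hm
    have hKpos : 0 < K := Nat.pos_of_ne_zero fun h ↦ N.factorial_ne_zero (by simp [hK, h])
    have hK' : (0 : ℝ) < K := by exact_mod_cast hKpos
    have hKr : (N ! : ℝ) = m * K := by exact_mod_cast hK
    have hmeas := measureReal_le_sum_norm_one_sub_integral_exp (ν := μ N)
      (f := fun y ↦ y i / N !) (by fun_prop) (by
        filter_upwards [hμπ N] with y hy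
        rw [abs_div, abs_of_pos hN, div_le_iff₀ hN]
        exact hy i) hKpos
    have hset : {y : ℕ → ℝ | 2 * Real.pi * m ≤ |y i|}
        = {y | 2 * Real.pi / K ≤ |y i / (N ! : ℝ)|} := by
      ext y
      change 2 * Real.pi * m ≤ |y i| ↔ 2 * Real.pi / K ≤ |y i / (N ! : ℝ)|
      rw [abs_div, abs_of_pos hN, le_div_iff₀ hN, hKr]
      field_simp
    rw [hset]
    refine hmeas.trans ?_
    have hterm (k : ℕ) (hk : k ∈ Finset.range K) :
        ‖1 - ∫ y, exp (I * ((k * (y i / N !) : ℝ) : ℂ)) ∂(μ N)‖ ≤ ε + 1 / (N + 1) := by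
      have hkK : (k : ℝ) ≤ K := by exact_mod_cast (Finset.mem_range.1 hk).le
      have hpair (y : ℕ → ℝ) :
          seqPairing (Finsupp.single i ((k : ℝ) / N !)) y = k * (y i / N !) := by
        rw [seqPairing, Finsupp.sum_single_index (by simp)]
        ring
      have h1 := hμω N (Finsupp.single i ((k : ℝ) / N !))
        (fun j hj ↦ Finsupp.single_eq_of_ne (by omega)) (fun j ↦ by
          by_cases hj : j = i
          · refine ⟨k, ?_, by simp [hj]⟩
            rw [Nat.abs_cast]
            have : k ≤ N ! := by
              rw [hK]
              exact (Finset.mem_range.1 hk).le.trans (Nat.le_mul_of_pos_left K hm)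
            exact_mod_cast this.trans (Nat.le_mul_of_pos_left _ (by omega))
          · exact ⟨0, by positivity, by simp [Finsupp.single_eq_of_ne hj]⟩)
      simp_rw [hpair] at h1
      have h2 := hε ((k : ℝ) / N !) (by positivity) (by
        rw [hKr, div_le_div_iff₀ (by positivity) hm']
        nlinarith)
      rw [norm_sub_rev] at h1
      exact (norm_sub_le_norm_sub_add_norm_sub _ _ _).trans (add_le_add h2 h1)
    calc _ ≤ 2 / (K : ℝ) * ∑ k ∈ Finset.range K, (ε + 1 / (N + 1)) := by
          gcongr with k hk
          exact hterm k hk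
      _ = _ := by
          rw [Finset.sum_const, Finset.card_range, nsmul_eq_mul]
          field_simp
  have htight : IsTightMeasureSet (Set.range μ) := by
    refine isTightMeasureSet_of_forall_coordinate fun i ε hε ↦ ?_
    obtain ⟨δ, hδ, hδε⟩ : ∃ δ : ℝ, 0 < δ ∧ ENNReal.ofReal δ ≤ ε := by
      obtain rfl | hε' := eq_or_ne ε ⊤
      · exact ⟨1, one_pos, le_top⟩
      · exact ⟨ε.toReal, ENNReal.toReal_pos hε.ne' hε', ENNReal.ofReal_toReal_le⟩
    obtain ⟨η, hη, hηω⟩ := Metric.continuousAt_iff.1 (hc i) (δ / 4) (by positivity)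
    obtain ⟨m, hm⟩ := exists_nat_one_div_lt hη
    obtain ⟨p, hp⟩ := exists_nat_one_div_lt (show 0 < δ / 4 by positivity)
    let N₀ := (m + 1) + (i + 1) + p
    refine ⟨max (2 * Real.pi * (m + 1 : ℕ)) (Real.pi * N₀ !), ?_⟩
    rintro _ ⟨N, rfl⟩
    obtain hN | hN := lt_or_ge N N₀
    · have : μ N {y | max (2 * Real.pi * (m + 1 : ℕ)) (Real.pi * N₀ !) < |y i|} = 0 := by
        refine measure_mono_null (fun y hy ↦ ?_) (ae_iff.1 (hμπ N))
        change ¬ ∀ i, |y i| ≤ Real.pi * (N ! : ℝ)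
        intro hcon
        have hle : (N ! : ℝ) ≤ N₀ ! := by exact_mod_cast Nat.factorial_le hN.le
        have hlt : Real.pi * N₀ ! < |y i| := (le_max_right _ _).trans_lt hy
        have := hcon i
        nlinarith [Real.pi_pos]
      rw [this]
      exact zero_le
    · have h := htail i (m + 1) N m.succ_pos (by omega) (by omega) (ε := δ / 4) fun t ht ht' ↦ by
        rw [norm_sub_rev, ← dist_eq_norm]
        have := @hηω t (by
          rw [Real.dist_eq, sub_zero, abs_of_nonneg ht]
          push_cast at ht'
          linarith)
        simpa [h0] using this.le
      have hpN : 1 / ((N : ℝ) + 1) ≤ 1 / (p + 1) := by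
        gcongr
        omega
      calc μ N {y | max (2 * Real.pi * (m + 1 : ℕ)) (Real.pi * N₀ !) < |y i|}
          ≤ μ N {y | 2 * Real.pi * (m + 1 : ℕ) ≤ |y i|} :=
            measure_mono fun y (hy : _ < |y i|) ↦
              show _ ≤ |y i| from ((le_max_left _ _).trans_lt hy).le
        _ = ENNReal.ofReal ((μ N).real {y | 2 * Real.pi * (m + 1 : ℕ) ≤ |y i|}) :=
            (ofReal_measureReal (measure_ne_top _ _)).symm
        _ ≤ ENNReal.ofReal δ := ENNReal.ofReal_le_ofReal (by linarith)
        _ ≤ ε := hδε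
  let P : ℕ → ProbabilityMeasure (ℕ → ℝ) := fun N ↦ ⟨μ N, hμ N⟩
  have hcompact : IsCompact (closure (Set.range P)) :=
    isCompact_closure_of_isTightMeasureSet (htight.subset (by
      rintro _ ⟨_, ⟨N, rfl⟩, rfl⟩
      exact ⟨N, rfl⟩))
  obtain ⟨μ', -, hμ'⟩ := hcompact.ultrafilter_le_nhds ((Filter.hyperfilter ℕ).map P) (by
    refine Filter.le_principal_iff.2 (Filter.mem_of_superset ?_ subset_closure)
    exact Filter.mem_map.2 (Filter.mem_of_superset Filter.univ_mem fun N _ ↦ ⟨N, rfl⟩))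
  have hlim : Filter.Tendsto P (Filter.hyperfilter ℕ) (nhds μ') := hμ'
  rw [ProbabilityMeasure.tendsto_iff_forall_integral_rclike_tendsto ℂ] at hlim
  refine ⟨μ', inferInstance, fun x hx ↦ ?_⟩
  choose q hq using hx
  let g : BoundedContinuousFunction (ℕ → ℝ) ℂ :=
    BoundedContinuousFunction.ofNormedAddCommGroup (fun y ↦ exp (I * (seqPairing x y : ℂ)))
      (by fun_prop) 1 fun y ↦ (norm_exp_I_mul_ofReal _).le
  have hat : Filter.Tendsto (fun N ↦ ∫ y, exp (I * (seqPairing x y : ℂ)) ∂(μ N))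
      Filter.atTop (nhds (ω x)) := by
    rw [tendsto_iff_norm_sub_tendsto_zero]
    refine squeeze_zero' (.of_forall fun N ↦ norm_nonneg _) ?_
      tendsto_one_div_add_atTop_nhds_zero_nat
    obtain ⟨n₀, hn₀⟩ := x.support.exists_nat_subset_range
    let N₀ := n₀ + ∑ i ∈ x.support, ((q i).den + (q i).num.natAbs)
    filter_upwards [Filter.eventually_ge_atTop N₀] with N hN
    have hNf : (0 : ℝ) < N ! := by exact_mod_cast N.factorial_pos
    refine hμω N x (fun i hi ↦ ?_) fun i ↦ ?_
    · by_contra hcon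
      have := Finset.mem_range.1 (hn₀ (Finsupp.mem_support_iff.2 hcon))
      omega
    · by_cases hi : i ∈ x.support
      · have hle : (q i).den + (q i).num.natAbs ≤ N := by
          refine le_trans ?_ ((Nat.le_add_left _ _).trans hN)
          exact Finset.single_le_sum (f := fun i ↦ (q i).den + (q i).num.natAbs)
            (fun _ _ ↦ Nat.zero_le _) hi
        obtain ⟨d, hd⟩ := Nat.dvd_factorial (q i).den_pos ((Nat.le_add_right _ _).trans hle)
        have hd0 : d ≠ 0 := fun h ↦ N.factorial_ne_zero (by simp [hd, h])
        refine ⟨(q i).num * d, ?_, ?_⟩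
        · rw [abs_mul, Int.abs_eq_natAbs, Nat.abs_cast]
          have : d ≤ N ! := by
            rw [hd]
            exact Nat.le_mul_of_pos_left d (q i).den_pos
          exact_mod_cast Nat.mul_le_mul ((Nat.le_add_left _ _).trans hle) this
        · have hden : ((q i).den : ℝ) ≠ 0 := by exact_mod_cast (q i).den_ne_zero
          have hd0' : (d : ℝ) ≠ 0 := by exact_mod_cast hd0
          rw [hq, hd, Rat.cast_def]
          push_cast
          field_simp
      · exact ⟨0, by positivity, by simpa using hi⟩
  exact tendsto_nhds_unique (hat.mono_left Nat.hyperfilter_le_atTop) (hlim g)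

/-- Bochner–Minlos for `ℝ^(ℕ)`, existence direction: every normalized positive
definite function `ω` on the group `ℝ^(ℕ)` of finitely supported real sequences, which is
continuous on every finite-dimensional subspace `ℝ^{n+1}`, is the Fourier transform of a Borel
probability measure `μ` on the product space `ℝ^ℕ`. -/
theorem stmt_1 (ω : (ℕ →₀ ℝ) → ℂ)
    (hnorm : ω 0 = 1)
    (hpd : ∀ (m : ℕ) (x : Fin m → (ℕ →₀ ℝ)) (c : Fin m → ℂ),
      (0 : ℂ) ≤ ∑ i : Fin m, ∑ j : Fin m, c i * starRingEnd ℂ (c j) * ω (x i - x j))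
    (hcont : ∀ n : ℕ, Continuous fun t : Fin (n + 1) → ℝ =>
      ω (∑ k : Fin (n + 1), Finsupp.single (k : ℕ) (t k))) :
    ∃ μ : Measure (ℕ → ℝ), IsProbabilityMeasure μ ∧
      ∀ x : ℕ →₀ ℝ,
        ω x = ∫ y : ℕ → ℝ,
          Complex.exp (Complex.I * ((x.sum fun n xn => xn * y n : ℝ) : ℂ)) ∂μ := by
  have hc (i : ℕ) : ContinuousAt (fun t : ℝ ↦ ω (Finsupp.single i t)) 0 := by
    have h := (hcont i).comp
      (continuous_pi fun k ↦ continuous_const.mul continuous_id :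
        Continuous fun (t : ℝ) (k : Fin (i + 1)) ↦ (if (k : ℕ) = i then (1 : ℝ) else 0) * t)
    convert h.continuousAt using 2 with t
    simp only [Function.comp_apply]
    congr 1
    ext j
    rw [sum_single_fin_apply, Finsupp.single_apply]
    split_ifs <;> first | omega | simp_all
  obtain ⟨μ, hμ, hμω⟩ := exists_measure_eq_integral_exp_of_rational hpd hnorm hc
  refine ⟨μ, hμ, fun x ↦ ?_⟩
  change ω x = ∫ y, exp (I * (seqPairing x y : ℂ)) ∂μ
  obtain ⟨n, hn⟩ := x.support.exists_nat_subset_range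
  have hx (i : ℕ) (hi : n + 1 ≤ i) : x i = 0 := by
    by_contra hcon
    have := Finset.mem_range.1 (hn (Finsupp.mem_support_iff.2 hcon))
    omega
  let e (t : Fin (n + 1) → ℝ) : ℕ →₀ ℝ := ∑ k : Fin (n + 1), Finsupp.single (k : ℕ) (t k)
  have hpair (t : Fin (n + 1) → ℝ) (y : ℕ → ℝ) : seqPairing (e t) y = ∑ i, t i * y i := by
    rw [seqPairing_eq_sum_fin (N := n + 1)
      fun i hi ↦ by rw [sum_single_fin_apply, dif_neg (by omega)]]
    refine Finset.sum_congr rfl fun i _ ↦ ?_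
    rw [sum_single_fin_apply, dif_pos i.isLt]
  have hint : Continuous fun t ↦ ∫ y, exp (I * (seqPairing (e t) y : ℂ)) ∂μ := by
    refine continuous_of_dominated (bound := fun _ ↦ 1) (fun t ↦ by fun_prop)
      (fun t ↦ .of_forall fun y ↦ (norm_exp_I_mul_ofReal _).le) (integrable_const _)
      (.of_forall fun y ↦ ?_)
    simp_rw [hpair]
    fun_prop
  have hdense : DenseRange (Pi.map fun (_ : Fin (n + 1)) (q : ℚ) ↦ (q : ℝ)) :=
    DenseRange.piMap fun _ ↦ Rat.denseRange_cast
  have heq := hdense.equalizer (hcont n) hint (funext fun q ↦ hμω _ fun i ↦ by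
    rw [sum_single_fin_apply]
    split_ifs with h
    · exact ⟨q ⟨i, h⟩, rfl⟩
    · exact ⟨0, by simp⟩)
  have := congrFun heq fun i ↦ x i
  simpa only [e, ← eq_sum_single_fin hx] using this
end

section
/- Let T be an index set and (X_t)_{t∈T} a family of complex vector spaces. Let x ∈ ∏_{t∈T} X_t and let F ⊆ T be a finite subset such that x_t ≠ 0 for all t ∉ F. Then there exists a ℂ-linear map φ_F : ⨂_{t∈T} X_t → ⨂_{t∈F} X_t such that: (a) for every y ∈ ∏_{t∈T} X_t with y_t = x_t for all t ∉ F one has φ_F(⨂_{t∈T} y_t) = ⨂_{t∈F} y_t; and (b) for every y that is NOT equivalent to x one has φ_F(⨂_{t∈T} y_t) = 0 (hence S(y) ⊆ ker φ_F for all y not equivalent to x). -/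
open scoped TensorProduct
open PiTensorProduct

/-- Changing one factor of a finitely supported product splits that factor off. -/
lemma finprod_update_eq_mul {T M : Type*} [DecidableEq T] [CommMonoid M] (g : T → M)
    (hg : g.HasFiniteMulSupport) (i : T) (a : M) :
    ∏ᶠ t, Function.update g i a t = a * ∏ᶠ t, Function.update g i 1 t := by
  have hsplit : ∀ t, Function.update g i a t =
      Function.update (1 : T → M) i a t * Function.update g i 1 t := by
    intro t
    by_cases h : t = i
    · subst h; simp
    · simp [h]
  have hfin₁ : (Function.update (1 : T → M) i a).HasFiniteMulSupport :=
    (Set.finite_singleton i).subset fun t ht => by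
      by_contra h
      exact ht (by simp [Function.update_of_ne h])
  have hfin₂ : (Function.update g i 1).HasFiniteMulSupport :=
    hg.subset fun t ht => by
      by_cases h : t = i
      · subst h; simp at ht
      · simpa [h] using ht
  rw [finprod_congr hsplit, finprod_mul_distrib hfin₁ hfin₂,
    finprod_eq_single _ i fun t ht => by simp [ht]]
  simp

/-- The sets of coordinates where `update y i a` and `y` differ from `x` are simultaneously
finite. -/
lemma finite_ne_update_iff {T : Type*} [DecidableEq T] {X : T → Type*} (x y : ∀ t, X t)
    (i : T) (a : X i) :
    {t | x t ≠ Function.update y i a t}.Finite ↔ {t | x t ≠ y t}.Finite := by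
  constructor <;> intro h <;> refine (h.insert i).subset fun t ht => ?_ <;>
    by_cases hti : t = i <;> simp_all

section Contraction

variable {K T : Type*} [Field K] {X : T → Type*} [∀ t, AddCommGroup (X t)]
  [∀ t, Module K (X t)]

lemma exists_dual_apply_eq_one {V : Type*} [AddCommGroup V] [Module K V] {v : V}
    (hv : v ≠ 0) : ∃ f : Module.Dual K V, f v = 1 := by
  obtain ⟨g, hg⟩ : ∃ g : Module.Dual K V, g v ≠ 0 := by
    by_contra! h
    exact hv ((Module.forall_dual_apply_eq_zero_iff K v).1 h)
  exact ⟨(g v)⁻¹ • g, by simp [hg]⟩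

open Classical in
/-- The scalar obtained by applying functionals to the coordinates of `y` outside `F`. -/
noncomputable def contractionCoeff (F : Finset T) (f : ∀ t, Module.Dual K (X t))
    (y : ∀ t, X t) : K :=
  ∏ᶠ t, if t ∈ F then 1 else f t (y t)

section Coeff

variable {F : Finset T} {f : ∀ t, Module.Dual K (X t)} {x : ∀ t, X t}

lemma contractionCoeff_eq_one (hf : ∀ t ∉ F, f t (x t) = 1) {y : ∀ t, X t}
    (hy : ∀ t ∉ F, y t = x t) : contractionCoeff F f y = 1 := by
  refine (finprod_congr fun t => ?_).trans finprod_one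
  by_cases ht : t ∈ F
  · simp [ht]
  · simp [ht, hy t ht, hf t ht]

open Classical in
lemma contractionCoeff_update [DecidableEq T] (hf : ∀ t ∉ F, f t (x t) = 1) {y : ∀ t, X t}
    (hy : {t | x t ≠ y t}.Finite) (i : T) : ∃ k : K, ∀ a : X i,
      contractionCoeff F f (Function.update y i a) = (if i ∈ F then 1 else f i a) * k := by
  refine ⟨∏ᶠ t, Function.update (fun t => if t ∈ F then 1 else f t (y t)) i 1 t,
    fun a => ?_⟩
  rw [← finprod_update_eq_mul]
  · refine finprod_congr fun t => ?_
    by_cases h : t = i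
    · subst h; simp
    · simp [h]
  · refine hy.subset fun t ht hxy => ht ?_
    by_cases htF : t ∈ F
    · simp [htF]
    · simp [htF, ← hxy, hf t htF]

end Coeff

open Classical in
/-- The multilinear map contracting the coordinates outside `F` of the families that agree with
`x` up to finitely many coordinates, and vanishing on all other families. -/
noncomputable def contraction (F : Finset T) (f : ∀ t, Module.Dual K (X t)) (x : ∀ t, X t)
    (hf : ∀ t ∉ F, f t (x t) = 1) : MultilinearMap K X (⨂[K] t : F, X t) where
  toFun y := if {t | x t ≠ y t}.Finite then
    contractionCoeff F f y • tprod K (fun t : F => y t) else 0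
  map_update_add' y i a b := by
    simp only [finite_ne_update_iff]
    split_ifs with hy
    · obtain ⟨k, hk⟩ := contractionCoeff_update hf hy i
      simp only [hk]
      by_cases hi : i ∈ F
      · have h (c : X i) : (fun t : F => Function.update y i c t) =
            Function.update (fun t : F => y t) ⟨i, hi⟩ c :=
          Function.update_comp_eq_of_injective' y Subtype.val_injective ⟨i, hi⟩ c
        simp [hi, h]
      · have h (c : X i) : (fun t : F => Function.update y i c t) = fun t : F => y t :=
          Function.update_comp_eq_of_forall_ne' y c fun t ht => hi (ht ▸ t.2)
        simp [hi, h, add_mul, add_smul]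
    · simp
  map_update_smul' y i r a := by
    simp only [finite_ne_update_iff]
    split_ifs with hy
    · obtain ⟨k, hk⟩ := contractionCoeff_update hf hy i
      simp only [hk]
      by_cases hi : i ∈ F
      · have h (c : X i) : (fun t : F => Function.update y i c t) =
            Function.update (fun t : F => y t) ⟨i, hi⟩ c :=
          Function.update_comp_eq_of_injective' y Subtype.val_injective ⟨i, hi⟩ c
        simp [hi, h, smul_comm r]
      · have h (c : X i) : (fun t : F => Function.update y i c t) = fun t : F => y t :=
          Function.update_comp_eq_of_forall_ne' y c fun t ht => hi (ht ▸ t.2)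
        simp [hi, h, mul_assoc, mul_smul]
    · simp

end Contraction

/-- if `x ∈ ∏_t X_t` and `F ⊆ T` is a finite set with `x t ≠ 0` for `t ∉ F`,
then there is a `ℂ`-linear map `φ_F : ⨂_{t∈T} X_t → ⨂_{t∈F} X_t` which sends an elementary
tensor `⨂ y_t` with `y_t = x_t` off `F` to `⨂_{t∈F} y_t`, and kills every elementary tensor
`⨂ y_t` with `y` not equivalent to `x` (hence the span `S(y)` of such tensors lies in its
kernel). -/
theorem stmt_3 {T : Type*} (X : T → Type*)
    [∀ t, AddCommGroup (X t)] [∀ t, Module ℂ (X t)]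
    (x : (t : T) → X t) (F : Finset T) (hx : ∀ t ∉ F, x t ≠ 0) :
    ∃ φ : (⨂[ℂ] t : T, X t) →ₗ[ℂ] ⨂[ℂ] t : F, X t,
      (∀ y : (t : T) → X t, (∀ t ∉ F, y t = x t) →
        φ (tprod ℂ y) = tprod ℂ (fun t : F => y t)) ∧
      (∀ y : (t : T) → X t, ¬ ({t : T | x t ≠ y t}).Finite →
        φ (tprod ℂ y) = 0) ∧
      (∀ y : (t : T) → X t, ¬ ({t : T | x t ≠ y t}).Finite →
        Submodule.span ℂ
            {v : ⨂[ℂ] t : T, X t | ∃ z : (t : T) → X t,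
              ({t : T | y t ≠ z t}).Finite ∧ v = tprod ℂ z}
          ≤ LinearMap.ker φ) := by
  have hdual (t : T) : ∃ f : Module.Dual ℂ (X t), t ∉ F → f (x t) = 1 := by
    by_cases ht : t ∈ F
    · exact ⟨0, fun h => absurd ht h⟩
    · obtain ⟨f, hf⟩ := exists_dual_apply_eq_one (K := ℂ) (hx t ht)
      exact ⟨f, fun _ => hf⟩
  choose f hf using hdual
  have hzero (y : (t : T) → X t) (hy : ¬ ({t : T | x t ≠ y t}).Finite) :
      lift (contraction F f x hf) (tprod ℂ y) = 0 := by
    rw [lift.tprod]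
    exact if_neg hy
  refine ⟨lift (contraction F f x hf), fun y hy => ?_, hzero, fun y hy => ?_⟩
  · have hfin : {t : T | x t ≠ y t}.Finite :=
      F.finite_toSet.subset fun t ht => by
        by_contra h
        exact ht (hy t h).symm
    rw [lift.tprod]
    refine (if_pos hfin).trans ?_
    rw [contractionCoeff_eq_one hf hy, one_smul]
  · rw [Submodule.span_le]
    rintro _ ⟨z, hz, rfl⟩
    refine hzero z fun hxz => hy ((hxz.union hz).subset fun t ht => ?_)
    by_contra h
    simp_all
end

section
/- Let T be an index set and (X_t)_{t∈T} a family of NONZERO complex vector spaces. For x ∈ ∏_{t∈T} X_t, the subspace S(x) of ⨂_{t∈T} X_t is nonzero if and only if the set {t ∈ T : x_t = 0} is finite. -/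
open scoped TensorProduct
open PiTensorProduct

section FinprodMultilinear

variable {T R : Type*} [CommSemiring R] {X : T → Type*}
  [∀ t, AddCommMonoid (X t)] [∀ t, Module R (X t)]

theorem mulSupport_apply_update_finite_iff [DecidableEq T] (f : ∀ t, X t →ₗ[R] R)
    (z : ∀ t, X t) (i : T) (a : X i) :
    (Function.mulSupport fun t => f t (Function.update z i a t)).Finite ↔
      (Function.mulSupport fun t => f t (z t)).Finite := by
  constructor <;> intro h <;> refine (h.insert i).subset fun t ht => ?_ <;>
    by_cases hti : t = i <;> simp_all

theorem finprod_apply_update [DecidableEq T] (f : ∀ t, X t →ₗ[R] R)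
    (z : ∀ t, X t) (i : T) (a : X i)
    (h : (Function.mulSupport fun t => f t (z t)).Finite) :
    ∏ᶠ t, f t (Function.update z i a t) = f i a * ∏ᶠ (t) (_ : t ≠ i), f t (z t) := by
  rw [← mul_finprod_cond_ne i ((mulSupport_apply_update_finite_iff f z i a).2 h),
    Function.update_self]
  congr 1
  exact finprod_congr fun t => finprod_congr fun hti => by rw [Function.update_of_ne hti]

open Classical in
/-- The multilinear map sending `z` to `∏ t, f t (z t)` if almost all factors are `1`,
and to `0` otherwise. -/
noncomputable def finprodMultilinear (f : ∀ t, X t →ₗ[R] R) : MultilinearMap R X R where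
  toFun z := if (Function.mulSupport fun t => f t (z t)).Finite then ∏ᶠ t, f t (z t) else 0
  map_update_add' z i a b := by
    simp only [mulSupport_apply_update_finite_iff]
    split_ifs with h
    · simp only [finprod_apply_update f z i _ h, map_add, add_mul]
    · simp
  map_update_smul' z i c a := by
    simp only [mulSupport_apply_update_finite_iff]
    split_ifs with h
    · simp only [finprod_apply_update f z i _ h, map_smul, smul_eq_mul, mul_assoc]
    · simp

theorem finprodMultilinear_eq_one {f : ∀ t, X t →ₗ[R] R} {z : ∀ t, X t}
    (h : ∀ t, f t (z t) = 1) : finprodMultilinear f z = 1 := by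
  simp [finprodMultilinear, h]

end FinprodMultilinear

theorem tprod_ne_zero_of_forall_ne_zero {T K : Type*} [Field K] {X : T → Type*}
    [∀ t, AddCommGroup (X t)] [∀ t, Module K (X t)] {y : ∀ t, X t} (hy : ∀ t, y t ≠ 0) :
    tprod K y ≠ 0 := by
  choose f hf using fun t => Module.Projective.exists_dual_eq_one K (hy t)
  intro h
  have hlift := lift.tprod (φ := finprodMultilinear f) y
  rw [h, map_zero, finprodMultilinear_eq_one hf] at hlift
  exact zero_ne_one hlift

/-- for a family of nonzero complex vector spaces `(X_t)_{t ∈ T}` and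
`x ∈ ∏_t X_t`, the subspace `S(x)` of `⨂_{t∈T} X_t` (the span of the elementary tensors
`⨂ y_t` with `y ∼ x`, i.e. `y` differs from `x` in only finitely many entries) is nonzero
if and only if `{t : x t = 0}` is finite. -/
theorem stmt_4 {T : Type*} (X : T → Type*)
    [∀ t, AddCommGroup (X t)] [∀ t, Module ℂ (X t)] [∀ t, Nontrivial (X t)]
    (x : (t : T) → X t) :
    Submodule.span ℂ
        {v : ⨂[ℂ] t : T, X t | ∃ y : (t : T) → X t,
          ({t : T | x t ≠ y t}).Finite ∧ v = tprod ℂ y} ≠ ⊥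
      ↔ ({t : T | x t = 0}).Finite := by
  classical
  constructor
  · intro h
    by_contra hinf
    refine h (Submodule.span_eq_bot.2 ?_)
    rintro _ ⟨y, hy, rfl⟩
    obtain ⟨t, ht, hty⟩ := Set.Infinite.exists_notMem_finite hinf hy
    have hyt : y t = 0 := (not_not.1 hty).symm.trans ht
    exact (PiTensorProduct.tprod ℂ).map_coord_zero t hyt
  · intro hfin hbot
    choose e he using fun t => exists_ne (0 : X t)
    have hy : ∀ t, (if x t = 0 then e t else x t) ≠ 0 := fun t => by
      split_ifs with h
      exacts [he t, h]
    refine tprod_ne_zero_of_forall_ne_zero (K := ℂ) hy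
      (Submodule.span_eq_bot.1 hbot _ ⟨_, hfin.subset fun t ht => ?_, rfl⟩)
    by_contra h
    exact ht (if_neg h).symm
end

section
/- Let T be an index set, (X_t)_{t∈T} a family of nonzero complex vector spaces, and x ∈ ∏_{t∈T} X_t with {t ∈ T : x_t = 0} finite. For finite subsets J ⊆ K of T define the ℂ-linear connecting maps φ_{K,J} : ⨂_{t∈J} X_t → ⨂_{t∈K} X_t by φ_{K,J}(⨂_{t∈J} y_t) = (⨂_{t∈J} y_t) ⊗ (⨂_{s∈K∖J} x_s) (filling the missing entries with the components of x). These form a direct system over the directed set of finite subsets of T ordered by inclusion, and the maps φ_J : ⨂_{t∈J} X_t → S(x) sending ⨂_{t∈J} y_t to the elementary tensor that equals y_t in the entries t ∈ J and x_s in the entries s ∉ J induce a ℂ-linear isomorphism from the direct limit lim→ (⨂_{t∈J} X_t, φ_{K,J}) onto S(x). -/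
open scoped TensorProduct
open PiTensorProduct

namespace PiTensorProduct

variable {R : Type*} {T : Type*} {X : T → Type*}

section Update

theorem dite_mem_update [DecidableEq T] {ι : Type*} [DecidableEq ι] {p : ι → T}
    (hp : p.Injective) (x : (t : T) → X t) (J : Finset T) [DecidableEq J] (y : (t : J) → X t)
    (i₀ : ι) (hi₀ : p i₀ ∈ J) (v : X (p i₀)) :
    (fun i => if h : p i ∈ J then Function.update y ⟨p i₀, hi₀⟩ v ⟨p i, h⟩ else x (p i)) =
      Function.update (fun i => if h : p i ∈ J then y ⟨p i, h⟩ else x (p i)) i₀ v := by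
  funext i
  by_cases hi : i = i₀
  · subst hi
    simp [hi₀]
  · have hne : ∀ h : p i ∈ J, (⟨p i, h⟩ : J) ≠ ⟨p i₀, hi₀⟩ := fun h e =>
      hi (hp (congrArg Subtype.val e))
    simp [hi, hne]

theorem finite_ne_update_iff [DecidableEq T] (x y : (t : T) → X t) (i : T) (v : X i) :
    {t | x t ≠ Function.update y i v t}.Finite ↔ {t | x t ≠ y t}.Finite := by
  constructor <;> intro h <;> refine (h.insert i).subset fun t ht => ?_ <;>
    by_cases hti : t = i <;> simp_all

theorem restrict_update_of_mem [DecidableEq T] {J : Finset T} (y : (t : T) → X t) {i : T}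
    (hi : i ∈ J) (v : X i) :
    (fun t : J => Function.update y i v t) =
      Function.update (fun t : J => y t) ⟨i, hi⟩ v := by
  funext t
  by_cases h : t = ⟨i, hi⟩
  · subst h
    simp
  · have : (t : T) ≠ i := fun e => h (Subtype.ext e)
    simp [h, this]

theorem restrict_update_of_notMem [DecidableEq T] {J : Finset T} (y : (t : T) → X t) {i : T}
    (hi : i ∉ J) (v : X i) :
    (fun t : J => Function.update y i v t) = fun t : J => y t := by
  funext t
  have : (t : T) ≠ i := fun e => hi (e ▸ t.2)
  simp [this]

end Update

section Fill

variable [CommSemiring R] [∀ t, AddCommMonoid (X t)] [∀ t, Module R (X t)] [DecidableEq T]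

variable (R) in
/-- The linear map `⨂_{t ∈ J} X t → ⨂_i X (p i)` which fills the entries outside `J` with the
components of `x`. -/
noncomputable def fill {ι : Type*} {p : ι → T}
    (hp : p.Injective) (x : (t : T) → X t) (J : Finset T) (hJ : ∀ t ∈ J, ∃ i, p i = t) :
    (⨂[R] t : J, X t) →ₗ[R] ⨂[R] i, X (p i) :=
  lift
    { toFun := fun y => tprod R fun i => if h : p i ∈ J then y ⟨p i, h⟩ else x (p i)
      map_update_add' := by
        classical
        intro _ y j v w
        obtain ⟨i₀, hi₀⟩ := hJ j j.2
        obtain ⟨j, hj⟩ := j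
        subst hi₀
        simp only [dite_mem_update hp x J y i₀ hj, MultilinearMap.map_update_add]
      map_update_smul' := by
        classical
        intro _ y j c v
        obtain ⟨i₀, hi₀⟩ := hJ j j.2
        obtain ⟨j, hj⟩ := j
        subst hi₀
        simp only [dite_mem_update hp x J y i₀ hj, MultilinearMap.map_update_smul] }

@[simp]
theorem fill_tprod {ι : Type*} {p : ι → T} (hp : p.Injective) (x : (t : T) → X t) (J : Finset T)
    (hJ : ∀ t ∈ J, ∃ i, p i = t) (y : (t : J) → X t) :
    fill R hp x J hJ (tprod R y) =
      tprod R fun i => if h : p i ∈ J then y ⟨p i, h⟩ else x (p i) :=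
  lift.tprod _

end Fill

section Contract

variable [CommSemiring R] [∀ t, AddCommMonoid (X t)] [∀ t, Module R (X t)]

theorem finprod_notMem_update [DecidableEq T] {x y : (t : T) → X t} (hy : {t | x t ≠ y t}.Finite)
    {J : Finset T} {f : (t : T) → X t →ₗ[R] R} (hf : ∀ t ∉ J, f t (x t) = 1)
    {i : T} (hi : i ∉ J) (v : X i) :
    ∏ᶠ (t) (_ : t ∉ J), f t (Function.update y i v t) =
      f i v * ∏ᶠ (t) (_ : t ≠ i) (_ : t ∉ J), f t (y t) := by
  have hfin : (fun t => ∏ᶠ (_ : t ∉ J), f t (Function.update y i v t)).HasFiniteMulSupport := by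
    refine ((finite_ne_update_iff x y i v).2 hy).subset fun t ht hxy => ht ?_
    dsimp only
    rw [← hxy]
    by_cases h : t ∈ J <;> simp [h, hf]
  rw [← mul_finprod_cond_ne i hfin]
  congr 1
  · simp [hi]
  · refine finprod_congr fun t => finprod_congr fun hti => ?_
    simp [hti]

theorem finprod_notMem_update_of_mem [DecidableEq T] {J : Finset T} (f : (t : T) → X t →ₗ[R] R)
    (y : (t : T) → X t) {i : T} (hi : i ∈ J) (v : X i) :
    ∏ᶠ (t) (_ : t ∉ J), f t (Function.update y i v t) = ∏ᶠ (t) (_ : t ∉ J), f t (y t) := by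
  refine finprod_congr fun t => finprod_congr fun ht => ?_
  have : t ≠ i := fun e => ht (e ▸ hi)
  simp [this]

open Classical in
/-- Given functionals `f t` with `f t (x t) = 1` for `t ∉ J`, the linear map
`⨂_t X t → ⨂_{t ∈ J} X t` which contracts the entries outside `J` of the elementary tensors of the
families equal to `x` at almost all indices, and kills all other elementary tensors. -/
noncomputable def contract (x : (t : T) → X t) (J : Finset T) (f : (t : T) → X t →ₗ[R] R)
    (hf : ∀ t ∉ J, f t (x t) = 1) : (⨂[R] t, X t) →ₗ[R] ⨂[R] t : J, X t :=
  lift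
    { toFun := fun y => if {t | x t ≠ y t}.Finite then
        (∏ᶠ (t) (_ : t ∉ J), f t (y t)) • tprod R (fun t : J => y t) else 0
      map_update_add' := by
        intro _ y i v w
        simp only [finite_ne_update_iff]
        split_ifs with hy
        · by_cases hi : i ∈ J
          · simp only [finprod_notMem_update_of_mem f y hi, restrict_update_of_mem y hi,
              MultilinearMap.map_update_add, smul_add]
          · simp only [finprod_notMem_update hy hf hi, restrict_update_of_notMem y hi, map_add,
              add_mul, add_smul]
        · simp
      map_update_smul' := by
        intro _ y i c v
        simp only [finite_ne_update_iff]
        split_ifs with hy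
        · by_cases hi : i ∈ J
          · simp only [finprod_notMem_update_of_mem f y hi, restrict_update_of_mem y hi,
              MultilinearMap.map_update_smul]
            rw [smul_comm]
          · simp only [finprod_notMem_update hy hf hi, restrict_update_of_notMem y hi, map_smul,
              smul_eq_mul, mul_assoc, mul_smul]
        · simp }

theorem contract_tprod {x : (t : T) → X t} {J : Finset T} {f : (t : T) → X t →ₗ[R] R}
    (hf : ∀ t ∉ J, f t (x t) = 1) {y : (t : T) → X t} (hy : ∀ t ∉ J, y t = x t) :
    contract x J f hf (tprod R y) = tprod R fun t : J => y t := by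
  have hfin : {t | x t ≠ y t}.Finite :=
    J.finite_toSet.subset fun t ht => by_contra fun h => ht (hy t h).symm
  have hprod : ∏ᶠ (t) (_ : t ∉ J), f t (y t) = 1 :=
    finprod_mem_eq_one_of_forall_eq_one fun t ht => by rw [hy t ht, hf t ht]
  refine (lift.tprod _).trans ?_
  simp [hfin, hprod]

end Contract

theorem fill_injective [Field R] [∀ t, AddCommGroup (X t)] [∀ t, Module R (X t)] [DecidableEq T]
    (x : (t : T) → X t) (J : Finset T) (hx : ∀ t ∉ J, x t ≠ 0) :
    Function.Injective
      (fill R (p := fun t : T => t) (fun _ _ h => h) x J fun t _ => ⟨t, rfl⟩) := by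
  have hex : ∀ t, ∃ f : X t →ₗ[R] R, t ∉ J → f (x t) = 1 := fun t => by
    by_cases ht : t ∈ J
    · exact ⟨0, fun h => absurd ht h⟩
    · obtain ⟨f, hf⟩ := Module.Projective.exists_dual_eq_one R (hx t ht)
      exact ⟨f, fun _ => hf⟩
  choose f hf using hex
  have hcomp : contract x J f hf ∘ₗ
      fill R (p := fun t : T => t) (fun _ _ h => h) x J (fun t _ => ⟨t, rfl⟩) = LinearMap.id := by
    ext y
    refine (congrArg (contract x J f hf)
      (fill_tprod (fun _ _ h => h) x J (fun t _ => ⟨t, rfl⟩) y)).trans ?_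
    refine (contract_tprod hf fun t ht => by simp [ht]).trans ?_
    simp
  exact Function.LeftInverse.injective (g := contract x J f hf) (LinearMap.congr_fun hcomp)

end PiTensorProduct

/-- for `x ∈ ∏_t X_t` with `{t : x t = 0}` finite, the connecting maps
`φ_{K,J} : ⨂_{t∈J} X_t → ⨂_{t∈K} X_t` (J ⊆ K finite) which fill in the missing entries with
the components of `x` form a direct system over the finite subsets of `T` ordered by
inclusion, and the maps `φ_J` into `S(x)` (filling all entries outside `J` with components
of `x`) induce a `ℂ`-linear isomorphism of the direct limit onto `S(x)`. -/
theorem stmt_5 {T : Type*} [DecidableEq T] (X : T → Type*)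
    [∀ t, AddCommGroup (X t)] [∀ t, Module ℂ (X t)] [∀ t, Nontrivial (X t)]
    (x : (t : T) → X t) (hx : ({t : T | x t = 0}).Finite) :
    ∃ φ : ∀ J K : Finset T, J ≤ K → ((⨂[ℂ] t : J, X t) →ₗ[ℂ] ⨂[ℂ] t : K, X t),
      (∀ (J K : Finset T) (h : J ≤ K) (y : (t : J) → X t),
        φ J K h (tprod ℂ y)
          = tprod ℂ (fun t : K => if ht : (t : T) ∈ J then y ⟨t, ht⟩ else x t)) ∧
      (∀ (J K L : Finset T) (hJK : J ≤ K) (hKL : K ≤ L),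
        (φ K L hKL).comp (φ J K hJK) = φ J L (le_trans hJK hKL)) ∧
      ∃ Φ : Module.DirectLimit (fun J : Finset T => ⨂[ℂ] t : J, X t) φ ≃ₗ[ℂ]
          (Submodule.span ℂ
            {v : ⨂[ℂ] t : T, X t | ∃ y : (t : T) → X t,
              ({t : T | x t ≠ y t}).Finite ∧ v = tprod ℂ y}),
        ∀ (J : Finset T) (y : (t : J) → X t),
          (Φ (Module.DirectLimit.of ℂ (Finset T)
                (fun J : Finset T => ⨂[ℂ] t : J, X t) φ J (tprod ℂ y)) :
              ⨂[ℂ] t : T, X t)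
            = tprod ℂ (fun t : T => if ht : t ∈ J then y ⟨t, ht⟩ else x t) := by
  let φ : ∀ J K : Finset T, J ≤ K → ((⨂[ℂ] t : J, X t) →ₗ[ℂ] ⨂[ℂ] t : K, X t) := fun J K h =>
    fill ℂ (p := fun t : K => (t : T)) Subtype.val_injective x J fun t ht => ⟨⟨t, h ht⟩, rfl⟩
  let ψ : ∀ J : Finset T, (⨂[ℂ] t : J, X t) →ₗ[ℂ] ⨂[ℂ] t : T, X t := fun J =>
    fill ℂ (p := fun t : T => t) (fun _ _ h => h) x J fun t _ => ⟨t, rfl⟩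
  have hφ : ∀ (J K : Finset T) (h : J ≤ K) (y : (t : J) → X t), φ J K h (tprod ℂ y)
      = tprod ℂ (fun t : K => if ht : (t : T) ∈ J then y ⟨t, ht⟩ else x t) :=
    fun J K h y => fill_tprod _ _ _ _ y
  have hψ : ∀ (J : Finset T) (y : (t : J) → X t), ψ J (tprod ℂ y)
      = tprod ℂ (fun t : T => if ht : t ∈ J then y ⟨t, ht⟩ else x t) :=
    fun J y => fill_tprod _ _ _ _ y
  have hψφ : ∀ (J K : Finset T) (h : J ≤ K) (z : ⨂[ℂ] t : J, X t), ψ K (φ J K h z) = ψ J z := by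
    intro J K h
    refine LinearMap.congr_fun (f := ψ K ∘ₗ φ J K h) (PiTensorProduct.ext ?_)
    ext y
    simp only [LinearMap.compMultilinearMap_apply, LinearMap.comp_apply, hφ, hψ]
    congr 1
    funext t
    by_cases hK : t ∈ K
    · simp [hK]
    · have hJ : t ∉ J := fun hJ => hK (h hJ)
      simp [hK, hJ]
  refine ⟨φ, hφ, ?_, ?_⟩
  · intro J K L hJK hKL
    ext y
    simp only [LinearMap.compMultilinearMap_apply, LinearMap.comp_apply, hφ]
    congr 1
    funext t
    by_cases hK : (t : T) ∈ K
    · simp [hK]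
    · have hJ : (t : T) ∉ J := fun hJ => hK (hJK hJ)
      simp [hK, hJ]
  · let F := Module.DirectLimit.lift ℂ (Finset T) (fun J : Finset T => ⨂[ℂ] t : J, X t) φ ψ hψφ
    have hF : ∀ J z, F (Module.DirectLimit.of ℂ (Finset T) _ φ J z) = ψ J z :=
      fun J z => Module.DirectLimit.lift_of _ _ _
    have hinj : Function.Injective F := by
      rw [injective_iff_map_eq_zero]
      intro z hz
      obtain ⟨J, w, rfl⟩ := Module.DirectLimit.exists_of z
      have hle : J ≤ J ∪ hx.toFinset := Finset.subset_union_left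
      rw [hF, ← hψφ J _ hle] at hz
      have hne : ∀ t ∉ J ∪ hx.toFinset, x t ≠ 0 := fun t ht h0 =>
        ht (Finset.mem_union_right _ (by simpa using h0))
      have hw : φ J _ hle w = 0 := fill_injective x _ hne (hz.trans (map_zero _).symm)
      rw [← Module.DirectLimit.of_f (hij := hle), hw, map_zero]
    have hrange : LinearMap.range F = Submodule.span ℂ
        {v : ⨂[ℂ] t : T, X t | ∃ y : (t : T) → X t,
          ({t : T | x t ≠ y t}).Finite ∧ v = tprod ℂ y} := by
      apply le_antisymm
      · rintro _ ⟨z, rfl⟩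
        obtain ⟨J, w, rfl⟩ := Module.DirectLimit.exists_of z
        rw [hF]
        induction w using PiTensorProduct.induction_on with
        | smul_tprod r y =>
          rw [map_smul, hψ]
          refine Submodule.smul_mem _ _ (Submodule.subset_span ⟨_, ?_, rfl⟩)
          refine J.finite_toSet.subset fun t ht => by_contra fun h => ht ?_
          have hJ : t ∉ J := h
          simp [hJ]
        | add a b ha hb =>
          rw [map_add]
          exact Submodule.add_mem _ ha hb
      · rw [Submodule.span_le]
        rintro _ ⟨y, hy, rfl⟩
        refine ⟨Module.DirectLimit.of ℂ (Finset T) _ φ hy.toFinset (tprod ℂ fun t => y t), ?_⟩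
        rw [hF, hψ]
        congr 1
        funext t
        by_cases h : x t = y t <;> simp [h]
    refine ⟨(LinearEquiv.ofInjective F hinj).trans (LinearEquiv.ofEq _ _ hrange), fun J y => ?_⟩
    exact (hF J _).trans (hψ J y)
end

section
/- Let T be an index set and (X_t)_{t∈T} a family of (not necessarily unital) associative complex algebras such that every element of every X_t is a product of two elements of X_t (i.e., X_t·X_t = X_t as sets, which holds for every C*-algebra by the Cohen factorization theorem). Then for all x, y ∈ ∏_{t∈T} X_t, the linear span of the set of products S(x)·S(y) equals S(x·y), where (x·y)_t := x_t y_t; i.e., as submodules of ⨂_{t∈T} X_t, S(x)·S(y) = S(x·y). -/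
open scoped TensorProduct
open PiTensorProduct

/-- if each (not necessarily unital) associative complex algebra `X_t` satisfies
`X_t·X_t = X_t` (every element is a product, as holds for C*-algebras by Cohen factorization),
then for the multiplication on `⨂_{t∈T} X_t` determined by
`(⨂ x_t)(⨂ y_t) = ⨂ (x_t y_t)`, the linear span of the set of products `S(x)·S(y)` equals
`S(x·y)`, where `(x·y)_t = x_t y_t`. -/
theorem stmt_8 {T : Type*} (X : T → Type*)
    [∀ t, NonUnitalRing (X t)] [∀ t, Module ℂ (X t)]
    [∀ t, SMulCommClass ℂ (X t) (X t)] [∀ t, IsScalarTower ℂ (X t) (X t)]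
    (hfact : ∀ t, ∀ z : X t, ∃ a b : X t, z = a * b)
    (mul : (⨂[ℂ] t : T, X t) →ₗ[ℂ] (⨂[ℂ] t : T, X t) →ₗ[ℂ] ⨂[ℂ] t : T, X t)
    (hmul : ∀ x y : (t : T) → X t,
      mul (tprod ℂ x) (tprod ℂ y) = tprod ℂ (fun t => x t * y t))
    (x y : (t : T) → X t) :
    Submodule.span ℂ
        {w : ⨂[ℂ] t : T, X t |
          ∃ a ∈ Submodule.span ℂ
              {v : ⨂[ℂ] t : T, X t | ∃ z : (t : T) → X t,
                ({t : T | x t ≠ z t}).Finite ∧ v = tprod ℂ z},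
          ∃ b ∈ Submodule.span ℂ
              {v : ⨂[ℂ] t : T, X t | ∃ z : (t : T) → X t,
                ({t : T | y t ≠ z t}).Finite ∧ v = tprod ℂ z},
            w = mul a b}
      = Submodule.span ℂ
          {v : ⨂[ℂ] t : T, X t | ∃ z : (t : T) → X t,
            ({t : T | x t * y t ≠ z t}).Finite ∧ v = tprod ℂ z} := by
  classical
  apply le_antisymm
  · rw [Submodule.span_le]
    rintro _ ⟨a, ha, b, hb, rfl⟩
    have hab := Submodule.apply_mem_map₂ mul ha hb
    rw [Submodule.map₂_span_span] at hab
    refine Submodule.span_mono ?_ hab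
    rintro _ ⟨_, ⟨u, hu, rfl⟩, _, ⟨v, hv, rfl⟩, rfl⟩
    refine ⟨fun t => u t * v t, (hu.union hv).subset fun t ht => ?_, hmul u v⟩
    by_contra huv
    simp only [Set.mem_union, Set.mem_ofPred_eq, not_or, not_not] at huv
    exact ht (by rw [huv.1, huv.2])
  · refine Submodule.span_mono ?_
    rintro _ ⟨z, hz, rfl⟩
    choose a b hab using fun t => hfact t (z t)
    let u : (t : T) → X t := fun t => if x t * y t = z t then x t else a t
    let v : (t : T) → X t := fun t => if x t * y t = z t then y t else b t
    have hu : {t : T | x t ≠ u t}.Finite :=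
      hz.subset fun t ht h => ht (if_pos h).symm
    have hv : {t : T | y t ≠ v t}.Finite :=
      hz.subset fun t ht h => ht (if_pos h).symm
    refine ⟨tprod ℂ u, Submodule.subset_span ⟨u, hu, rfl⟩,
      tprod ℂ v, Submodule.subset_span ⟨v, hv, rfl⟩, ?_⟩
    rw [hmul]
    congr 1
    funext t
    by_cases h : x t * y t = z t
    · simp [u, v, h]
    · simpa [u, v, h] using hab t
end

section
/- Let T be an index set and (X_t)_{t∈T} a family of (not necessarily unital) associative complex algebras. For each t ∈ T let G_t ⊆ X_t ∖ {0} be a nonempty multiplicative subsemigroup (closed under the multiplication of X_t). Then the submodule M := ⨆ { S(a) : a ∈ ∏_{t∈T} G_t } of ⨂_{t∈T} X_t (the set of all finite sums of elements of the subspaces S(a) with a_t ∈ G_t for all t) is a (non-unital) subalgebra of ⨂_{t∈T} X_t, i.e., it is closed under multiplication: M·M ⊆ M. -/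
open scoped TensorProduct
open PiTensorProduct

/-- if `G_t ⊆ X_t ∖ {0}` is a nonempty multiplicative subsemigroup of each
(not necessarily unital) associative complex algebra `X_t`, then the submodule
`M = ⨆ {S(a) : a_t ∈ G_t for all t}` of `⨂_{t∈T} X_t` is closed under the multiplication
determined on elementary tensors by `(⨂ x_t)(⨂ y_t) = ⨂ (x_t y_t)`, i.e. `M·M ⊆ M`. -/
theorem stmt_9 {T : Type*} (X : T → Type*)
    [∀ t, NonUnitalRing (X t)] [∀ t, Module ℂ (X t)]
    [∀ t, SMulCommClass ℂ (X t) (X t)] [∀ t, IsScalarTower ℂ (X t) (X t)]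
    (G : ∀ t, Set (X t))
    (hGne : ∀ t, (G t).Nonempty)
    (hG0 : ∀ t, (0 : X t) ∉ G t)
    (hGmul : ∀ t, ∀ a ∈ G t, ∀ b ∈ G t, a * b ∈ G t)
    (mul : (⨂[ℂ] t : T, X t) →ₗ[ℂ] (⨂[ℂ] t : T, X t) →ₗ[ℂ] ⨂[ℂ] t : T, X t)
    (hmul : ∀ x y : (t : T) → X t,
      mul (tprod ℂ x) (tprod ℂ y) = tprod ℂ (fun t => x t * y t)) :
    ∀ p ∈ (⨆ a : {a : (t : T) → X t // ∀ t, a t ∈ G t},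
        Submodule.span ℂ
          {v : ⨂[ℂ] t : T, X t | ∃ z : (t : T) → X t,
            ({t : T | a.1 t ≠ z t}).Finite ∧ v = tprod ℂ z}),
    ∀ q ∈ (⨆ a : {a : (t : T) → X t // ∀ t, a t ∈ G t},
        Submodule.span ℂ
          {v : ⨂[ℂ] t : T, X t | ∃ z : (t : T) → X t,
            ({t : T | a.1 t ≠ z t}).Finite ∧ v = tprod ℂ z}),
      mul p q ∈ (⨆ a : {a : (t : T) → X t // ∀ t, a t ∈ G t},
        Submodule.span ℂ
          {v : ⨂[ℂ] t : T, X t | ∃ z : (t : T) → X t,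
            ({t : T | a.1 t ≠ z t}).Finite ∧ v = tprod ℂ z}) := by
  intro p hp q hq
  rw [← Submodule.span_iUnion] at hp hq ⊢
  have hpq := Submodule.apply_mem_map₂ mul hp hq
  rw [Submodule.map₂_span_span] at hpq
  refine Submodule.span_mono ?_ hpq
  rintro _ ⟨v, hv, w, hw, rfl⟩
  obtain ⟨a, x, hax, rfl⟩ := Set.mem_iUnion.mp hv
  obtain ⟨b, y, hby, rfl⟩ := Set.mem_iUnion.mp hw
  refine Set.mem_iUnion.mpr
    ⟨⟨fun t => a.1 t * b.1 t, fun t => hGmul t _ (a.2 t) _ (b.2 t)⟩,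
      fun t => x t * y t, (hax.union hby).subset fun t ht => ?_, hmul x y⟩
  by_contra h
  simp only [Set.mem_union, Set.mem_ofPred_eq, not_or, not_not] at h
  exact ht (congrArg₂ (· * ·) h.1 h.2)
end

section
/- Let H be a complex Hilbert space and (T_n)_{n∈ℕ} a sequence of pairwise commuting positive contractions on H. Then for every k ∈ ℕ there exists a bounded operator F_k on H with 0 ≤ F_k ≤ 1 such that the partial products T_k T_{k+1} ⋯ T_n converge to F_k in the strong operator topology as n → ∞, i.e., for every ψ ∈ H, T_k T_{k+1} ⋯ T_n ψ → F_k ψ in H. -/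
open Filter ContinuousLinearMap

/-- The partial product `T_k T_{k+1} ⋯ T_n` of a sequence of operators. -/
noncomputable def partialProd {H : Type*} [NormedAddCommGroup H] [InnerProductSpace ℂ H]
    (T : ℕ → H →L[ℂ] H) (k n : ℕ) : H →L[ℂ] H :=
  (((List.range (n + 1 - k)).map fun i => T (k + i))).prod

/-- A decreasing sequence of positive operators below `1` converges in the strong operator
topology to a positive contraction. -/
theorem exists_tendsto_apply_of_antitone {H : Type*} [NormedAddCommGroup H]
    [InnerProductSpace ℂ H] [CompleteSpace H] {P : ℕ → H →L[ℂ] H} (hanti : Antitone P)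
    (hP0 : ∀ n, 0 ≤ P n) (hP1 : ∀ n, P n ≤ 1) :
    ∃ F : H →L[ℂ] H, F.IsPositive ∧ ‖F‖ ≤ 1 ∧
      ∀ ψ : H, Tendsto (fun n => P n ψ) atTop (nhds (F ψ)) := by
  have hpos : ∀ n, (P n).IsPositive := fun n => (nonneg_iff_isPositive _).1 (hP0 n)
  have hsq : ∀ ψ n m, n ≤ m →
      ‖P n ψ - P m ψ‖ ^ 2 ≤ (P n).reApplyInnerSelf ψ - (P m).reApplyInnerSelf ψ := by
    intro ψ n m hnm
    have hD0 : 0 ≤ P n - P m := sub_nonneg.2 (hanti hnm)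
    have hD1 : P n - P m ≤ 1 := (sub_le_self _ (hP0 m)).trans (hP1 n)
    have hmul : 0 ≤ (P n - P m) * (1 - (P n - P m)) :=
      Commute.mul_nonneg hD0 (sub_nonneg.2 hD1) ((Commute.one_right _).sub_right (Commute.refl _))
    have h := ((nonneg_iff_isPositive _).1 hmul).re_inner_nonneg_left ψ
    have hsymm := ((nonneg_iff_isPositive _).1 hD0).inner_left_eq_inner_right ((P n - P m) ψ) ψ
    rw [mul_sub, mul_one, sub_apply (P n - P m), mul_apply_eq_comp, inner_sub_left, hsymm, map_sub,
      inner_self_eq_norm_sq] at h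
    simp only [sub_apply, inner_sub_left, map_sub] at h
    simp only [reApplyInnerSelf_apply]
    linarith
  have hconv : ∀ ψ, ∃ φ, Tendsto (fun n => P n ψ) atTop (nhds φ) := by
    intro ψ
    have ha : Antitone fun n => (P n).reApplyInnerSelf ψ := fun n m hnm =>
      sub_nonneg.1 ((sq_nonneg _).trans (hsq ψ n m hnm))
    have hb : BddBelow (Set.range fun n => (P n).reApplyInnerSelf ψ) :=
      ⟨0, by rintro _ ⟨n, rfl⟩; exact (hpos n).re_inner_nonneg_left ψ⟩
    have hc := (tendsto_atTop_ciInf ha hb).cauchySeq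
    apply cauchySeq_tendsto_of_complete
    rw [Metric.cauchySeq_iff'] at hc ⊢
    intro ε hε
    obtain ⟨N, hN⟩ := hc (ε ^ 2) (by positivity)
    refine ⟨N, fun n hn => ?_⟩
    have h := hN n hn
    rw [dist_comm, Real.dist_eq] at h
    rw [dist_comm, dist_eq_norm]
    exact lt_of_pow_lt_pow_left₀ 2 hε.le
      (((hsq ψ N n hn).trans (le_abs_self _)).trans_lt h)
  choose f hf using hconv
  let F : H →L[ℂ] H := continuousLinearMapOfTendsto P (tendsto_pi_nhds.2 hf)
  have hF : ∀ ψ, Tendsto (fun n => P n ψ) atTop (nhds (F ψ)) := hf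
  refine ⟨F, ?_, ?_, hF⟩
  · refine isPositive_def.2 ⟨fun φ ψ => ?_, fun ψ => ?_⟩
    · exact tendsto_nhds_unique ((hF φ).inner tendsto_const_nhds)
        ((tendsto_const_nhds.inner (hF ψ)).congr fun n =>
          ((hpos n).inner_left_eq_inner_right φ ψ).symm)
    · exact ge_of_tendsto'
        ((RCLike.continuous_re.tendsto _).comp ((hF ψ).inner tendsto_const_nhds))
        fun n => (hpos n).re_inner_nonneg_left ψ
  · refine opNorm_le_bound _ zero_le_one fun ψ => ?_
    refine le_of_tendsto (hF ψ).norm (Eventually.of_forall fun n => ?_)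
    exact (P n).le_of_opNorm_le
      ((CStarAlgebra.norm_le_one_iff_of_nonneg (P n) (hP0 n)).2 (hP1 n)) ψ

/-- for a sequence `(T_n)` of pairwise commuting positive contractions on a
complex Hilbert space `H` and every `k`, the partial products `T_k T_{k+1} ⋯ T_n` converge
in the strong operator topology, as `n → ∞`, to a bounded operator `F_k` with
`0 ≤ F_k ≤ 1` (i.e. `F_k` is a positive contraction). -/
theorem stmt_10 {H : Type*} [NormedAddCommGroup H] [InnerProductSpace ℂ H] [CompleteSpace H]
    (T : ℕ → H →L[ℂ] H)
    (hpos : ∀ n, (T n).IsPositive) (hnorm : ∀ n, ‖T n‖ ≤ 1)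
    (hcomm : ∀ n m, Commute (T n) (T m)) (k : ℕ) :
    ∃ F : H →L[ℂ] H, F.IsPositive ∧ ‖F‖ ≤ 1 ∧
      ∀ ψ : H, Tendsto (fun n => partialProd T k n ψ) atTop (nhds (F ψ)) := by
  have hT0 : ∀ n, 0 ≤ T n := fun n => (nonneg_iff_isPositive _).2 (hpos n)
  have hT1 : ∀ n, T n ≤ 1 := fun n =>
    (CStarAlgebra.norm_le_one_iff_of_nonneg (T n) (hT0 n)).1 (hnorm n)
  let P : ℕ → H →L[ℂ] H := fun n => ((List.range n).map fun i => T (k + i)).prod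
  have hsucc : ∀ n, P (n + 1) = P n * T (k + n) := fun n => by
    simp [P, List.range_succ]
  have hPcomm : ∀ n m, Commute (P n) (T m) := fun n m =>
    Commute.list_prod_left _ _ fun x hx => by
      obtain ⟨i, -, rfl⟩ := List.mem_map.1 hx
      exact hcomm _ _
  have hP0 : ∀ n, 0 ≤ P n := by
    intro n
    induction n with
    | zero => simp [P]
    | succ n ih => exact hsucc n ▸ Commute.mul_nonneg ih (hT0 _) (hPcomm _ _)
  have hanti : Antitone P := antitone_nat_of_succ_le fun n => by
    have h := Commute.mul_nonneg (hP0 n) (sub_nonneg.2 (hT1 (k + n)))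
      ((Commute.one_right _).sub_right (hPcomm n (k + n)))
    rw [mul_sub, mul_one, sub_nonneg] at h
    exact hsucc n ▸ h
  have hP1 : ∀ n, P n ≤ 1 := fun n => (hanti n.zero_le).trans_eq (by simp [P])
  obtain ⟨F, hF0, hF1, hF⟩ := exists_tendsto_apply_of_antitone hanti hP0 hP1
  refine ⟨F, hF0, hF1, fun ψ => (hF ψ).comp
    (tendsto_atTop_atTop.2 fun b => ⟨b + k, fun n hn => ?_⟩)⟩
  omega
end

section
/- Let H be a complex Hilbert space and (T_n)_{n∈ℕ} a sequence of pairwise commuting positive contractions on H. For ℓ, k ∈ ℕ let F_k^{(ℓ)} denote the strong-operator limit of the products T_k^ℓ T_{k+1}^ℓ ⋯ T_n^ℓ as n → ∞ (which exists). Then: (a) for each ℓ, the sequence (F_k^{(ℓ)})_k is increasing and converges in the strong operator topology as k → ∞ to an operator P^{(ℓ)}; (b) P^{(ℓ)} is an orthogonal projection (P^{(ℓ)} is positive and idempotent); (c) P^{(ℓ)} is independent of ℓ, i.e., P^{(ℓ)} = P^{(1)} =: P for all ℓ ≥ 1; and (d) F_k^{(ℓ)} P = F_k^{(ℓ)} for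 all k, ℓ. -/
open Filter ContinuousLinearMap

section PartialProd

variable {H : Type*} [NormedAddCommGroup H] [InnerProductSpace ℂ H] (S : ℕ → H →L[ℂ] H)

theorem partialProd_self (k : ℕ) : partialProd S k k = S k := by
  simp [partialProd]

theorem partialProd_add_succ (k j : ℕ) :
    partialProd S k (k + (j + 1)) = partialProd S k (k + j) * S (k + j + 1) := by
  have h₁ : k + (j + 1) + 1 - k = j + 1 + 1 := by omega
  have h₂ : k + j + 1 - k = j + 1 := by omega
  rw [partialProd, partialProd, h₁, h₂, List.range_succ, List.map_append, List.prod_append]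
  simp [add_assoc]

theorem partialProd_eq_mul {k n : ℕ} (h : k < n) :
    partialProd S k n = S k * partialProd S (k + 1) n := by
  have h₁ : n + 1 - k = n + 1 - (k + 1) + 1 := by omega
  rw [partialProd, partialProd, h₁, List.range_succ_eq_map, List.map_cons, List.prod_cons,
    List.map_map]
  simp [Function.comp_def, add_assoc, add_comm 1]

variable {S}

theorem commute_partialProd {A : H →L[ℂ] H} (h : ∀ i, Commute A (S i)) (k n : ℕ) :
    Commute A (partialProd S k n) := by
  refine Commute.list_prod_right _ _ fun B hB => ?_
  obtain ⟨i, -, rfl⟩ := List.mem_map.1 hB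
  exact h _

theorem partialProd_pow (hcomm : ∀ i j, Commute (S i) (S j)) (ℓ k j : ℕ) :
    partialProd (fun i => S i ^ ℓ) k (k + j) = partialProd S k (k + j) ^ ℓ := by
  induction j with
  | zero => simp [partialProd_self]
  | succ j ih =>
    rw [partialProd_add_succ, partialProd_add_succ, ih,
      (commute_partialProd (hcomm _) _ _).symm.mul_pow]

theorem norm_partialProd_add_le_one (h : ∀ i, ‖S i‖ ≤ 1) (k j : ℕ) :
    ‖partialProd S k (k + j)‖ ≤ 1 := by
  induction j with
  | zero => simpa [partialProd_self] using h k
  | succ j ih =>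
    rw [partialProd_add_succ]
    exact (norm_mul_le _ _).trans (mul_le_one₀ ih (norm_nonneg _) (h _))

theorem partialProd_add_nonneg [CompleteSpace H] (h : ∀ i, 0 ≤ S i)
    (hcomm : ∀ i j, Commute (S i) (S j)) (k j : ℕ) : 0 ≤ partialProd S k (k + j) := by
  induction j with
  | zero => simpa [partialProd_self] using h k
  | succ j ih =>
    rw [partialProd_add_succ]
    exact Commute.mul_nonneg ih (h _) (commute_partialProd (hcomm _) _ _).symm

end PartialProd

section StrongLimits

variable {H : Type*} [NormedAddCommGroup H] [InnerProductSpace ℂ H]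
  {A : ℕ → H →L[ℂ] H} {B : H →L[ℂ] H}

theorem tendsto_apply_of_norm_le_one (hA : ∀ n, ‖A n‖ ≤ 1)
    (h : ∀ ψ, Tendsto (fun n => A n ψ) atTop (nhds (B ψ))) {x : ℕ → H} {y : H}
    (hx : Tendsto x atTop (nhds y)) : Tendsto (fun n => A n (x n)) atTop (nhds (B y)) := by
  have h₀ : Tendsto (fun n => A n (x n - y)) atTop (nhds 0) := by
    refine squeeze_zero_norm (fun n => (A n).le_of_opNorm_le (hA n) _) ?_
    simpa using (tendsto_iff_norm_sub_tendsto_zero.1 hx)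
  simpa using h₀.add (h y)

theorem tendsto_pow_apply_of_norm_le_one (hA : ∀ n, ‖A n‖ ≤ 1)
    (h : ∀ ψ, Tendsto (fun n => A n ψ) atTop (nhds (B ψ))) (ℓ : ℕ) (ψ : H) :
    Tendsto (fun n => (A n ^ ℓ) ψ) atTop (nhds ((B ^ ℓ) ψ)) := by
  induction ℓ with
  | zero => simp
  | succ ℓ ih => simpa [pow_succ'] using tendsto_apply_of_norm_le_one hA h ih

theorem norm_le_one_of_tendsto_apply (hA : ∀ n, ‖A n‖ ≤ 1)
    (h : ∀ ψ, Tendsto (fun n => A n ψ) atTop (nhds (B ψ))) : ‖B‖ ≤ 1 :=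
  B.opNorm_le_bound zero_le_one fun ψ =>
    le_of_tendsto (h ψ).norm (Eventually.of_forall fun n => (A n).le_of_opNorm_le (hA n) ψ)

theorem nonneg_of_tendsto_apply (hA : ∀ n, 0 ≤ A n)
    (h : ∀ ψ, Tendsto (fun n => A n ψ) atTop (nhds (B ψ))) : 0 ≤ B := by
  rw [nonneg_iff_isPositive, isPositive_iff_complex]
  intro ψ
  have hin : Tendsto (fun n => inner ℂ (A n ψ) ψ) atTop (nhds (inner ℂ (B ψ) ψ)) :=
    (h ψ).inner tendsto_const_nhds
  have hpos n := (isPositive_iff_complex _).1 ((nonneg_iff_isPositive _).1 (hA n)) ψ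
  refine ⟨tendsto_nhds_unique
    ((Complex.continuous_ofReal.comp RCLike.continuous_re).continuousAt.tendsto.comp hin)
    (hin.congr fun n => (hpos n).1.symm), ?_⟩
  exact ge_of_tendsto ((RCLike.continuous_re.tendsto _).comp hin)
    (Eventually.of_forall fun n => (hpos n).2)

variable [CompleteSpace H]

theorem norm_apply_sq_le_re_inner {C : H →L[ℂ] H} (h₀ : 0 ≤ C) (h₁ : C ≤ 1) (ψ : H) :
    ‖C ψ‖ ^ 2 ≤ (inner ℂ (C ψ) ψ).re := by
  have hC : 0 ≤ C * (1 - C) :=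
    Commute.mul_nonneg h₀ (sub_nonneg.2 h₁) ((Commute.one_right C).sub_right (Commute.refl C))
  have hpos := (nonneg_iff_isPositive C).1 h₀
  have h := ((nonneg_iff_isPositive _).1 hC).re_inner_nonneg_left ψ
  have e : inner ℂ (C (C ψ)) ψ = inner ℂ (C ψ) (C ψ) := hpos.inner_left_eq_inner_right _ _
  have e' : (inner ℂ (C ψ) (C ψ)).re = ‖C ψ‖ ^ 2 := inner_self_eq_norm_sq (𝕜 := ℂ) (C ψ)
  simp only [mul_sub, mul_one, sub_apply, inner_sub_left, map_sub] at h
  change 0 ≤ (inner ℂ (C ψ) ψ).re - (inner ℂ (C (C ψ)) ψ).re at h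
  rw [e, e'] at h
  linarith

/-- A bounded increasing sequence of positive operators converges strongly. -/
theorem exists_tendsto_apply_of_monotone (hmono : Monotone A) (h₀ : ∀ n, 0 ≤ A n)
    (h₁ : ∀ n, A n ≤ 1) : ∃ P : H →L[ℂ] H, ∀ ψ, Tendsto (fun n => A n ψ) atTop (nhds (P ψ)) := by
  have hlim : ∀ ψ, ∃ y, Tendsto (fun n => A n ψ) atTop (nhds y) := by
    intro ψ
    set u : ℕ → ℝ := fun n => (inner ℂ (A n ψ) ψ).re with hu
    have hdiff : ∀ m n, m ≤ n → ‖A n ψ - A m ψ‖ ^ 2 ≤ u n - u m := fun m n hmn => by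
      have := norm_apply_sq_le_re_inner (sub_nonneg.2 (hmono hmn))
        ((sub_le_self _ (h₀ m)).trans (h₁ n)) ψ
      simpa [inner_sub_left] using this
    have humono : Monotone u := fun m n hmn => by
      linarith [hdiff m n hmn, sq_nonneg ‖A n ψ - A m ψ‖]
    have hbdd : BddAbove (Set.range u) := by
      refine ⟨(inner ℂ ψ ψ).re, ?_⟩
      rintro _ ⟨n, rfl⟩
      have := (h₁ n : (1 - A n).IsPositive).re_inner_nonneg_left ψ
      simpa [inner_sub_left, hu] using this
    have hcau : CauchySeq u := (tendsto_atTop_ciSup humono hbdd).cauchySeq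
    refine cauchySeq_tendsto_of_complete (Metric.cauchySeq_iff'.2 fun ε hε => ?_)
    obtain ⟨N, hN⟩ := Metric.cauchySeq_iff'.1 hcau (ε ^ 2) (by positivity)
    refine ⟨N, fun n hn => ?_⟩
    rw [dist_eq_norm]
    refine lt_of_pow_lt_pow_left₀ 2 hε.le ((hdiff N n hn).trans_lt ?_)
    exact (le_abs_self _).trans_lt (hN n hn)
  choose f hf using hlim
  exact ⟨continuousLinearMapOfTendsto A (tendsto_pi_nhds.2 hf), hf⟩

end StrongLimits

section TailProducts

variable {H : Type*} [NormedAddCommGroup H] [InnerProductSpace ℂ H] {S G : ℕ → H →L[ℂ] H}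

theorem tendsto_partialProd_add
    (hG : ∀ k ψ, Tendsto (fun n => partialProd S k n ψ) atTop (nhds (G k ψ))) (k : ℕ) (ψ : H) :
    Tendsto (fun j => partialProd S k (k + j) ψ) atTop (nhds (G k ψ)) :=
  (hG k ψ).comp (tendsto_add_atTop_nat k |>.congr fun j => add_comm j k)

theorem tailProd_eq_mul
    (hG : ∀ k ψ, Tendsto (fun n => partialProd S k n ψ) atTop (nhds (G k ψ))) (k : ℕ) :
    G k = S k * G (k + 1) := by
  ext ψ
  refine tendsto_nhds_unique (hG k ψ)
    ((((S k).continuous.tendsto _).comp (hG (k + 1) ψ)).congr' ?_)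
  filter_upwards [eventually_gt_atTop k] with n hn
  simp [partialProd_eq_mul S hn]

theorem tailProd_eq_partialProd_mul
    (hG : ∀ k ψ, Tendsto (fun n => partialProd S k n ψ) atTop (nhds (G k ψ))) (k j : ℕ) :
    G k = partialProd S k (k + j) * G (k + j + 1) := by
  induction j with
  | zero => simpa [partialProd_self] using tailProd_eq_mul hG k
  | succ j ih =>
    rw [partialProd_add_succ, mul_assoc, ← add_assoc, ← tailProd_eq_mul hG, ← ih]

theorem commute_tailProd (hcomm : ∀ i j, Commute (S i) (S j))
    (hG : ∀ k ψ, Tendsto (fun n => partialProd S k n ψ) atTop (nhds (G k ψ))) (i k : ℕ) :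
    Commute (S i) (G k) := by
  ext ψ
  refine tendsto_nhds_unique (((S i).continuous.tendsto _).comp (hG k ψ))
    ((hG k (S i ψ)).congr fun n => ?_)
  exact (congrArg (· ψ) (commute_partialProd (hcomm i) k n).eq).symm

variable [CompleteSpace H]

theorem tailProd_mono (h₀ : ∀ i, 0 ≤ S i) (h₁ : ∀ i, ‖S i‖ ≤ 1)
    (hcomm : ∀ i j, Commute (S i) (S j))
    (hG : ∀ k ψ, Tendsto (fun n => partialProd S k n ψ) atTop (nhds (G k ψ))) :
    Monotone G := by
  refine monotone_nat_of_le_succ fun k => sub_nonneg.1 ?_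
  have hk : 0 ≤ G (k + 1) := nonneg_of_tendsto_apply
    (partialProd_add_nonneg h₀ hcomm _) (tendsto_partialProd_add hG _)
  have e : G (k + 1) - G k = (1 - S k) * G (k + 1) := by
    rw [sub_mul, one_mul, ← tailProd_eq_mul hG]
  rw [e]
  exact Commute.mul_nonneg
    (sub_nonneg.2 ((CStarAlgebra.norm_le_one_iff_of_nonneg _ (h₀ k)).1 (h₁ k))) hk
    ((Commute.one_left _).sub_left (commute_tailProd hcomm hG _ _))

theorem exists_tendsto_tailProd (h₀ : ∀ i, 0 ≤ S i) (h₁ : ∀ i, ‖S i‖ ≤ 1)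
    (hcomm : ∀ i j, Commute (S i) (S j))
    (hG : ∀ k ψ, Tendsto (fun n => partialProd S k n ψ) atTop (nhds (G k ψ))) :
    ∃ P : H →L[ℂ] H, (∀ ψ, Tendsto (fun k => G k ψ) atTop (nhds (P ψ))) ∧
      0 ≤ P ∧ P * P = P ∧ ∀ k, G k * P = G k := by
  have hG₀ k : 0 ≤ G k := nonneg_of_tendsto_apply
    (partialProd_add_nonneg h₀ hcomm k) (tendsto_partialProd_add hG k)
  have hG₁ k : ‖G k‖ ≤ 1 := norm_le_one_of_tendsto_apply
    (norm_partialProd_add_le_one h₁ k) (tendsto_partialProd_add hG k)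
  obtain ⟨P, hP⟩ := exists_tendsto_apply_of_monotone (tailProd_mono h₀ h₁ hcomm hG) hG₀
    fun k => (CStarAlgebra.norm_le_one_iff_of_nonneg _ (hG₀ k)).1 (hG₁ k)
  have hGP k : G k * P = G k := by
    ext ψ
    have hshift : Tendsto (fun j => G (k + j + 1) ψ) atTop (nhds (P ψ)) :=
      (hP ψ).comp ((tendsto_add_atTop_nat (k + 1)).congr fun j => by omega)
    refine tendsto_nhds_unique (tendsto_apply_of_norm_le_one (norm_partialProd_add_le_one h₁ k)
      (tendsto_partialProd_add hG k) hshift) (tendsto_const_nhds.congr fun j => ?_)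
    exact congrArg (· ψ) (tailProd_eq_partialProd_mul hG k j)
  refine ⟨P, hP, nonneg_of_tendsto_apply hG₀ hP, ?_, hGP⟩
  ext ψ
  exact tendsto_nhds_unique (hP (P ψ)) ((hP ψ).congr fun k => (congrArg (· ψ) (hGP k)).symm)

end TailProducts

/-- let `(T_n)` be pairwise commuting positive contractions on a complex
Hilbert space and `F_k^{(ℓ)} = s-lim_n T_k^ℓ ⋯ T_n^ℓ`. Then (a) for each `ℓ ≥ 1` the sequence
`(F_k^{(ℓ)})_k` is increasing and converges strongly as `k → ∞` to an operator `P^{(ℓ)}`;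
(b) each `P^{(ℓ)}` is an orthogonal projection (positive and idempotent); (c) `P^{(ℓ)}` is
independent of `ℓ`; and (d) `F_k^{(ℓ)} P^{(ℓ)} = F_k^{(ℓ)}` for all `k, ℓ`. -/
theorem stmt_11 {H : Type*} [NormedAddCommGroup H] [InnerProductSpace ℂ H] [CompleteSpace H]
    (T : ℕ → H →L[ℂ] H)
    (hpos : ∀ n, (T n).IsPositive) (hnorm : ∀ n, ‖T n‖ ≤ 1)
    (hcomm : ∀ n m, Commute (T n) (T m))
    (F : ℕ → ℕ → H →L[ℂ] H)
    (hF : ∀ k ℓ : ℕ, ∀ ψ : H,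
      Tendsto (fun n => partialProd (fun i => T i ^ ℓ) k n ψ) atTop (nhds (F k ℓ ψ))) :
    ∃ P : ℕ → H →L[ℂ] H,
      (∀ ℓ, 1 ≤ ℓ →
        (∀ k, (F (k + 1) ℓ - F k ℓ).IsPositive) ∧
        ∀ ψ : H, Tendsto (fun k => F k ℓ ψ) atTop (nhds (P ℓ ψ))) ∧
      (∀ ℓ, 1 ≤ ℓ → (P ℓ).IsPositive ∧ P ℓ * P ℓ = P ℓ) ∧
      (∀ ℓ, 1 ≤ ℓ → P ℓ = P 1) ∧
      (∀ k ℓ, 1 ≤ ℓ → F k ℓ * P ℓ = F k ℓ) := by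
  have hT₀ n : 0 ≤ T n := (nonneg_iff_isPositive _).2 (hpos n)
  have hS₀ ℓ i : 0 ≤ T i ^ ℓ := by
    induction ℓ with
    | zero => rw [pow_zero]; exact zero_le_one
    | succ ℓ ih =>
      rw [pow_succ]
      exact Commute.mul_nonneg ih (hT₀ i) ((Commute.refl (T i)).pow_left ℓ)
  have hS₁ ℓ i : ‖T i ^ ℓ‖ ≤ 1 := by
    induction ℓ with
    | zero => rw [pow_zero]; exact norm_id_le
    | succ ℓ ih =>
      rw [pow_succ]
      exact (norm_mul_le _ _).trans (mul_le_one₀ ih (norm_nonneg _) (hnorm i))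
  have hS ℓ i j : Commute (T i ^ ℓ) (T j ^ ℓ) := (hcomm i j).pow_pow ℓ ℓ
  choose P hP hP₀ hPP hFP using fun ℓ =>
    exists_tendsto_tailProd (hS₀ ℓ) (hS₁ ℓ) (hS ℓ) fun k ψ => hF k ℓ ψ
  have hF₁ k ψ : Tendsto (fun j => partialProd T k (k + j) ψ) atTop (nhds (F k 1 ψ)) :=
    tendsto_partialProd_add (fun k ψ => by simpa using hF k 1 ψ) k ψ
  have hpow k ℓ : F k ℓ = F k 1 ^ ℓ := by
    ext ψ
    refine tendsto_nhds_unique (tendsto_partialProd_add (fun k ψ => hF k ℓ ψ) k ψ)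
      ((tendsto_pow_apply_of_norm_le_one (norm_partialProd_add_le_one hnorm k)
        (hF₁ k) ℓ ψ).congr fun j => ?_)
    rw [partialProd_pow hcomm]
  refine ⟨P, fun ℓ _ => ⟨fun k => ?_, hP ℓ⟩,
    fun ℓ _ => ⟨(nonneg_iff_isPositive _).1 (hP₀ ℓ), hPP ℓ⟩, fun ℓ hℓ => ?_, fun k ℓ _ => hFP ℓ k⟩
  · exact tailProd_mono (hS₀ ℓ) (hS₁ ℓ) (hS ℓ) (fun k ψ => hF k ℓ ψ) k.le_succ
  · have hPpow : P 1 ^ ℓ = P 1 := (show IsIdempotentElem (P 1) from hPP 1).pow_eq (by omega)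
    rw [← hPpow]
    ext ψ
    refine tendsto_nhds_unique (hP ℓ ψ) ((tendsto_pow_apply_of_norm_le_one
      (fun k => norm_le_one_of_tendsto_apply (norm_partialProd_add_le_one hnorm k) (hF₁ k))
      (hP 1) ℓ ψ).congr fun k => ?_)
    rw [hpow k ℓ]
end

section
/- Let H be a complex Hilbert space and (T_n)_{n∈ℕ} a sequence of pairwise commuting positive contractions on H, and for ℓ, k ∈ ℕ let F_k^{(ℓ)} denote the strong-operator limit of T_k^ℓ T_{k+1}^ℓ ⋯ T_n^ℓ as n → ∞. Then for all k ≤ m and all ℓ, j ∈ ℕ one has the operator identity F_k^{(ℓ)} F_m^{(j)} = T_k^ℓ T_{k+1}^ℓ ⋯ T_{m−1}^ℓ · F_m^{(ℓ+j)}; in particular F_m^{(ℓ)} F_m^{(j)} = F_m^{(ℓ+j)}. -/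
open Filter ContinuousLinearMap

theorem norm_list_prod_le_one {H : Type*} [NormedAddCommGroup H] [InnerProductSpace ℂ H]
    (l : List (H →L[ℂ] H)) (hl : ∀ A ∈ l, ‖A‖ ≤ 1) : ‖l.prod‖ ≤ 1 := by
  induction l with
  | nil => exact ContinuousLinearMap.norm_id_le
  | cons A l ih =>
    rw [List.prod_cons]
    exact (norm_mul_le _ _).trans (mul_le_one₀ (hl A (by simp)) (norm_nonneg _)
      (ih fun B hB => hl B (by simp [hB])))

theorem norm_pow_le_one_of_norm_le_one {H : Type*} [NormedAddCommGroup H]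
    [InnerProductSpace ℂ H] {A : H →L[ℂ] H} (hA : ‖A‖ ≤ 1) (n : ℕ) : ‖A ^ n‖ ≤ 1 := by
  rw [← List.prod_replicate]
  refine norm_list_prod_le_one _ fun B hB => ?_
  rwa [List.eq_of_mem_replicate hB]

/-- Multiplication is jointly sequentially strongly continuous when the left factors are
contractions. -/
theorem tendsto_mul_apply_of_norm_le_one {H : Type*} [NormedAddCommGroup H]
    [InnerProductSpace ℂ H] {A B : ℕ → H →L[ℂ] H} {A₀ B₀ : H →L[ℂ] H}
    (hA : ∀ n, ‖A n‖ ≤ 1)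
    (hAlim : ∀ ψ, Tendsto (fun n => A n ψ) atTop (nhds (A₀ ψ)))
    (hBlim : ∀ ψ, Tendsto (fun n => B n ψ) atTop (nhds (B₀ ψ))) (ψ : H) :
    Tendsto (fun n => (A n * B n) ψ) atTop (nhds ((A₀ * B₀) ψ)) := by
  have hdiff : Tendsto (fun n => A n (B n ψ - B₀ ψ)) atTop (nhds 0) := by
    refine squeeze_zero_norm (fun n => ?_)
      (tendsto_iff_norm_sub_tendsto_zero.mp (hBlim ψ))
    simpa using (A n).le_of_opNorm_le (hA n) (B n ψ - B₀ ψ)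
  simpa using hdiff.add (hAlim (B₀ ψ))

theorem list_prod_map_pow_mul_list_prod_map_pow {M : Type*} [Monoid M] {a : ℕ → M}
    (ha : ∀ i i', Commute (a i) (a i')) (ℓ j n : ℕ) :
    ((List.range n).map fun i => a i ^ ℓ).prod * ((List.range n).map fun i => a i ^ j).prod =
      ((List.range n).map fun i => a i ^ (ℓ + j)).prod := by
  induction n with
  | zero => simp
  | succ n ih =>
    have hc : Commute (a n ^ ℓ) ((List.range n).map fun i => a i ^ j).prod := by
      refine Commute.list_prod_right _ _ fun x hx => ?_
      obtain ⟨i, -, rfl⟩ := List.mem_map.mp hx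
      exact (ha n i).pow_pow ℓ j
    simp only [List.prod_range_succ, pow_add] at ih ⊢
    rw [← ih, mul_assoc, ← mul_assoc (a n ^ ℓ), hc.eq]
    simp only [mul_assoc]

theorem partialProd_eq_mul_s12 {H : Type*} [NormedAddCommGroup H] [InnerProductSpace ℂ H]
    (T : ℕ → H →L[ℂ] H) {k m n : ℕ} (hkm : k ≤ m) (hmn : m ≤ n) :
    partialProd T k n =
      ((List.range (m - k)).map fun i => T (k + i)).prod * partialProd T m n := by
  have hlen : n + 1 - k = (m - k) + (n + 1 - m) := by omega
  have hidx : ∀ i, k + (m - k + i) = m + i := fun i => by omega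
  simp [partialProd, hlen, List.range_add, Function.comp_def, hidx]

/-- let `(T_n)` be pairwise commuting positive contractions on a complex
Hilbert space and `F_k^{(ℓ)} = s-lim_n T_k^ℓ ⋯ T_n^ℓ`. Then for `k ≤ m` and all `ℓ, j`,
`F_k^{(ℓ)} F_m^{(j)} = T_k^ℓ ⋯ T_{m-1}^ℓ · F_m^{(ℓ+j)}`; in particular
`F_m^{(ℓ)} F_m^{(j)} = F_m^{(ℓ+j)}`. -/
theorem stmt_12 {H : Type*} [NormedAddCommGroup H] [InnerProductSpace ℂ H] [CompleteSpace H]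
    (T : ℕ → H →L[ℂ] H)
    (hpos : ∀ n, (T n).IsPositive) (hnorm : ∀ n, ‖T n‖ ≤ 1)
    (hcomm : ∀ n m, Commute (T n) (T m))
    (F : ℕ → ℕ → H →L[ℂ] H)
    (hF : ∀ k ℓ : ℕ, ∀ ψ : H,
      Tendsto (fun n => partialProd (fun i => T i ^ ℓ) k n ψ) atTop (nhds (F k ℓ ψ)))
    (k m : ℕ) (hkm : k ≤ m) (ℓ j : ℕ) :
    F k ℓ * F m j = (((List.range (m - k)).map fun i => T (k + i) ^ ℓ)).prod * F m (ℓ + j) ∧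
    F m ℓ * F m j = F m (ℓ + j) := by
  have hmul : F m ℓ * F m j = F m (ℓ + j) := by
    ext ψ
    have hbound : ∀ n, ‖partialProd (fun i => T i ^ ℓ) m n‖ ≤ 1 := fun n => by
      refine norm_list_prod_le_one _ fun A hA => ?_
      obtain ⟨i, -, rfl⟩ := List.mem_map.mp hA
      exact norm_pow_le_one_of_norm_le_one (hnorm _) ℓ
    refine tendsto_nhds_unique
      (tendsto_mul_apply_of_norm_le_one hbound (hF m ℓ) (hF m j) ψ) ?_
    refine (hF m (ℓ + j) ψ).congr fun n => ?_
    exact congrArg (fun A : H →L[ℂ] H => A ψ) (list_prod_map_pow_mul_list_prod_map_pow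
      (a := fun i => T (m + i)) (fun _ _ => hcomm _ _) ℓ j (n + 1 - m)).symm
  have hsplit : F k ℓ = ((List.range (m - k)).map fun i => T (k + i) ^ ℓ).prod * F m ℓ := by
    ext ψ
    refine tendsto_nhds_unique (hF k ℓ ψ) ?_
    refine (((ContinuousLinearMap.continuous _).tendsto _).comp (hF m ℓ ψ)).congr' ?_
    filter_upwards [eventually_ge_atTop m] with n hn
    rw [partialProd_eq_mul_s12 _ hkm hn]
    rfl
  exact ⟨by rw [hsplit, mul_assoc, hmul], hmul⟩
end

section
/- Let H be a complex Hilbert space, (T_n)_{n∈ℕ} a sequence of pairwise commuting positive contractions on H, and ψ ∈ H a vector with ‖T_nψ − ψ‖ ≤ 1/n² for all n. For each k let F_k := s-lim_{n→∞} T_k T_{k+1} ⋯ T_n (which exists). Then F_k ψ → ψ as k → ∞; equivalently, the projection P := s-lim_{k→∞} F_k satisfies Pψ = ψ. -/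
open Filter ContinuousLinearMap

/-- A product of contractions is a contraction. -/
theorem norm_prod_map_range_le_one {H : Type*} [NormedAddCommGroup H] [InnerProductSpace ℂ H]
    {T : ℕ → H →L[ℂ] H} (hT : ∀ n, ‖T n‖ ≤ 1) (k m : ℕ) :
    ‖((List.range m).map fun i => T (k + i)).prod‖ ≤ 1 := by
  induction m with
  | zero => exact ContinuousLinearMap.norm_id_le
  | succ m ih =>
    rw [List.range_succ, List.map_append, List.prod_append, List.map_singleton,
      List.prod_singleton]
    exact (norm_mul_le _ _).trans (mul_le_one₀ ih (norm_nonneg _) (hT _))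

/-- A product of contractions moves a vector by at most the sum of the displacements caused by
the factors. -/
theorem norm_prod_apply_sub_le_sum {H : Type*} [NormedAddCommGroup H] [InnerProductSpace ℂ H]
    {T : ℕ → H →L[ℂ] H} (hT : ∀ n, ‖T n‖ ≤ 1) (ψ : H) (k m : ℕ) :
    ‖((List.range m).map fun i => T (k + i)).prod ψ - ψ‖ ≤
      ∑ i ∈ Finset.range m, ‖T (k + i) ψ - ψ‖ := by
  induction m with
  | zero => simp
  | succ m ih =>
    rw [List.range_succ, List.map_append, List.prod_append, List.map_singleton,
      List.prod_singleton, Finset.sum_range_succ, ContinuousLinearMap.mul_def,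
      ContinuousLinearMap.comp_apply]
    set A := ((List.range m).map fun i => T (k + i)).prod
    have hA1 : ‖A (T (k + m) ψ - ψ)‖ ≤ ‖T (k + m) ψ - ψ‖ :=
      A.le_of_opNorm_le (norm_prod_map_range_le_one hT k m) _ |>.trans_eq (one_mul _)
    calc ‖A (T (k + m) ψ) - ψ‖ = ‖(A ψ - ψ) + A (T (k + m) ψ - ψ)‖ := by
          rw [map_sub]; congr 1; abel
      _ ≤ _ := (norm_add_le _ _).trans (add_le_add ih hA1)

/-- let `(T_n)` be pairwise commuting positive contractions on a complex
Hilbert space and `ψ` a vector with `‖T_n ψ - ψ‖ ≤ 1/n²` for all `n ≥ 1`. If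
`F_k = s-lim_n T_k ⋯ T_n` and `P = s-lim_k F_k`, then `F_k ψ → ψ` as `k → ∞`;
equivalently the projection `P` satisfies `P ψ = ψ`. -/
theorem stmt_15 {H : Type*} [NormedAddCommGroup H] [InnerProductSpace ℂ H] [CompleteSpace H]
    (T : ℕ → H →L[ℂ] H)
    (hpos : ∀ n, (T n).IsPositive) (hnorm : ∀ n, ‖T n‖ ≤ 1)
    (hcomm : ∀ n m, Commute (T n) (T m))
    (ψ : H) (hψ : ∀ n, 1 ≤ n → ‖T n ψ - ψ‖ ≤ 1 / (n : ℝ) ^ 2)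
    (F : ℕ → H →L[ℂ] H)
    (hF : ∀ k : ℕ, ∀ φ : H, Tendsto (fun n => partialProd T k n φ) atTop (nhds (F k φ)))
    (P : H →L[ℂ] H)
    (hP : ∀ φ : H, Tendsto (fun k => F k φ) atTop (nhds (P φ))) :
    Tendsto (fun k => F k ψ) atTop (nhds ψ) ∧ P ψ = ψ := by
  have hsum : Summable fun n : ℕ => 1 / (n : ℝ) ^ 2 :=
    Real.summable_one_div_nat_pow.2 one_lt_two
  have hbound : ∀ k, 1 ≤ k → ‖F k ψ - ψ‖ ≤ ∑' i : ℕ, 1 / ((i + k : ℕ) : ℝ) ^ 2 := by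
    intro k hk
    refine le_of_tendsto ((hF k ψ).sub_const ψ).norm (Eventually.of_forall fun n => ?_)
    refine (norm_prod_apply_sub_le_sum hnorm ψ k (n + 1 - k)).trans ?_
    refine (Finset.sum_le_sum fun i _ => ?_).trans
      (((summable_nat_add_iff k).2 hsum).sum_le_tsum (Finset.range (n + 1 - k))
        fun i _ => by positivity)
    rw [add_comm i k]
    exact hψ (k + i) (by omega)
  have hlim : Tendsto (fun k => F k ψ) atTop (nhds ψ) := by
    rw [tendsto_iff_norm_sub_tendsto_zero]
    refine squeeze_zero' (Eventually.of_forall fun _ => norm_nonneg _) ?_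
      (tendsto_sum_nat_add fun n : ℕ => 1 / (n : ℝ) ^ 2)
    filter_upwards [eventually_ge_atTop 1] with k hk using hbound k hk
  exact ⟨hlim, tendsto_nhds_unique (hP ψ) hlim⟩
end
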